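/- arXiv:1901.07735 — 6 statements merged into one kernel-verified Lean document; each statement's English description precedes it below -/
import Mathlib

section
/- Let G be the hypertree HT(n) with n ≥ 1, and let S be a dominating set of G of minimum cardinality (i.e. |S| = γ(G)). Then S contains at least 2^{n-1} vertices whose labels lie in levels n-1 and n, i.e. |S ∩ {x : 2^{n-1} ≤ x ≤ 2^{n+1}-1}| ≥ 2^{n-1}. -/
/-- Vertex labels of a level-`n` complete binary tree: `1, …, 2^(n+1) - 1`. -/
def treeVerts (n : ℕ) : Finset ℕ := Finset.Icc 1 (2 ^ (n + 1) - 1)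

/-- The hypertree `HT(n)`: each vertex `x` is adjacent to its children `2x` and `2x+1`
(when the labels lie in the vertex set), and two vertices at the same level `i`
(`1 ≤ i ≤ n`, i.e. `2^i ≤ x < 2^(i+1)`) are adjacent iff their labels differ by `2^(i-1)`. -/
def hyperTree (n : ℕ) : SimpleGraph ℕ :=
  SimpleGraph.fromRel (fun x y =>
    x ∈ treeVerts n ∧ y ∈ treeVerts n ∧
      (y = 2 * x ∨ y = 2 * x + 1 ∨
        ∃ i, 1 ≤ i ∧ i ≤ n ∧ 2 ^ i ≤ x ∧ x < 2 ^ (i + 1) ∧ 2 ^ i ≤ y ∧ y < 2 ^ (i + 1) ∧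
          y = x + 2 ^ (i - 1)))

/-- The root-fault hypertree `HT*(n)`: the induced subgraph of `HT(n)` obtained by
deleting the root vertex `1`. -/
def rootFaultHyperTree (n : ℕ) : SimpleGraph ℕ :=
  SimpleGraph.fromRel (fun x y => x ≠ 1 ∧ y ≠ 1 ∧ (hyperTree n).Adj x y)

/-- Vertex labels of the root-fault hypertree `HT*(n)`: `2, …, 2^(n+1) - 1`. -/
def rootFaultVerts (n : ℕ) : Finset ℕ := Finset.Icc 2 (2 ^ (n + 1) - 1)

/-- The sibling tree `ST_n`: each vertex `x` is adjacent to its children `2x` and `2x+1`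
(when the labels lie in the vertex set), and the two children `2p`, `2p+1` of a common
parent are adjacent. -/
def siblingTree (n : ℕ) : SimpleGraph ℕ :=
  SimpleGraph.fromRel (fun x y =>
    x ∈ treeVerts n ∧ y ∈ treeVerts n ∧
      (y = 2 * x ∨ y = 2 * x + 1 ∨ ∃ p, x = 2 * p ∧ y = 2 * p + 1))

/-- `S` is a dominating set of the graph `G` with (finite) vertex set `V`:
every vertex of `V` not in `S` is adjacent to some vertex of `S`. -/
def IsDomSetOn (G : SimpleGraph ℕ) (V S : Finset ℕ) : Prop :=
  S ⊆ V ∧ ∀ v ∈ V, v ∉ S → ∃ u ∈ S, G.Adj u v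

/-- `S` is a total dominating set of the graph `G` with (finite) vertex set `V`:
every vertex of `V` is adjacent to some vertex of `S`. -/
def IsTotalDomSetOn (G : SimpleGraph ℕ) (V S : Finset ℕ) : Prop :=
  S ⊆ V ∧ ∀ v ∈ V, ∃ u ∈ S, G.Adj u v

/-- `S` locates the vertices of `V` outside `S`: any two distinct vertices `u, v` of `V`
outside `S` satisfy `N(u) ∩ S ≠ N(v) ∩ S`. -/
def LocatesOn (G : SimpleGraph ℕ) (V S : Finset ℕ) : Prop :=
  ∀ u ∈ V, ∀ v ∈ V, u ∉ S → v ∉ S → u ≠ v →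
    ({w : ℕ | w ∈ S ∧ G.Adj w u} ≠ {w : ℕ | w ∈ S ∧ G.Adj w v})

/-- `S` is a locating-dominating set of `G` with vertex set `V`. -/
def IsLocDomSetOn (G : SimpleGraph ℕ) (V S : Finset ℕ) : Prop :=
  IsDomSetOn G V S ∧ LocatesOn G V S

/-- `S` is a locating-total dominating set of `G` with vertex set `V`. -/
def IsLocTotalDomSetOn (G : SimpleGraph ℕ) (V S : Finset ℕ) : Prop :=
  IsTotalDomSetOn G V S ∧ LocatesOn G V S

/-- The domination number `γ` of the graph `G` with vertex set `V`. -/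
noncomputable def domNum (G : SimpleGraph ℕ) (V : Finset ℕ) : ℕ :=
  sInf {k | ∃ S : Finset ℕ, IsDomSetOn G V S ∧ S.card = k}

/-- The total domination number `γ_t` of the graph `G` with vertex set `V`. -/
noncomputable def totalDomNum (G : SimpleGraph ℕ) (V : Finset ℕ) : ℕ :=
  sInf {k | ∃ S : Finset ℕ, IsTotalDomSetOn G V S ∧ S.card = k}

/-- The locating-domination number `γ^L` of the graph `G` with vertex set `V`. -/
noncomputable def locDomNum (G : SimpleGraph ℕ) (V : Finset ℕ) : ℕ :=
  sInf {k | ∃ S : Finset ℕ, IsLocDomSetOn G V S ∧ S.card = k}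

/-- The locating-total domination number `γ^L_t` of the graph `G` with vertex set `V`. -/
noncomputable def locTotalDomNum (G : SimpleGraph ℕ) (V : Finset ℕ) : ℕ :=
  sInf {k | ∃ S : Finset ℕ, IsLocTotalDomSetOn G V S ∧ S.card = k}

/-- The bottom-level vertices dominated by `u` in `HT(n)`: for `u` in level `n` these are `u` and
the vertex of level `n` matched to it, for `u` in level `n - 1` its two children. -/
def bottomDominated (n u : ℕ) : Finset ℕ :=
  if u < 2 ^ n then {2 * u, 2 * u + 1}
  else if u < 2 ^ n + 2 ^ (n - 1) then {u, u + 2 ^ (n - 1)}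
  else {u, u - 2 ^ (n - 1)}

theorem card_bottomDominated_le (n u : ℕ) : (bottomDominated n u).card ≤ 2 := by
  unfold bottomDominated
  split_ifs <;> exact Finset.card_le_two

theorem self_mem_bottomDominated {n u : ℕ} (hu : 2 ^ n ≤ u) : u ∈ bottomDominated n u := by
  unfold bottomDominated
  split_ifs <;> first | omega | simp

theorem mem_bottomDominated_of_adj {n u v : ℕ} (hn : 1 ≤ n) (hv : 2 ^ n ≤ v)
    (h : (hyperTree n).Adj u v) : 2 ^ (n - 1) ≤ u ∧ v ∈ bottomDominated n u := by
  have hpow : 2 ^ n = 2 * 2 ^ (n - 1) := by rw [← pow_succ', Nat.sub_add_cancel hn]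
  have hpow' : 2 ^ (n + 1) = 2 * 2 ^ n := pow_succ' 2 n
  have level_eq : ∀ i, i ≤ n → v < 2 ^ (i + 1) → i = n := by
    intro i hi hlt
    have : n < i + 1 := (Nat.pow_lt_pow_iff_right one_lt_two).1 (hv.trans_lt hlt)
    omega
  simp only [hyperTree, SimpleGraph.fromRel_adj, treeVerts, Finset.mem_Icc] at h
  unfold bottomDominated
  obtain ⟨-, ⟨hu, hv', rfl | rfl | ⟨i, -, hin, h1, h2, h3, h4, rfl⟩⟩ |
    ⟨hv', hu, rfl | rfl | ⟨i, -, hin, h1, h2, h3, h4, rfl⟩⟩⟩ := h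
  · rw [if_pos (by omega)]; exact ⟨by omega, by simp⟩
  · rw [if_pos (by omega)]; exact ⟨by omega, by simp⟩
  · obtain rfl := level_eq i hin h4
    rw [if_neg (by omega), if_pos (by omega)]
    exact ⟨by omega, by simp⟩
  · omega
  · omega
  · obtain rfl := level_eq i hin h2
    rw [if_neg (by omega), if_neg (by omega)]
    exact ⟨by omega, by simp⟩

/-- Any dominating set of `HT(n)`, minimum or not, has at least `2 ^ (n - 1)` vertices in the last
two levels: each vertex there dominates at most two of the `2 ^ n` bottom vertices, and no other
vertex dominates any. -/
theorem IsDomSetOn.two_pow_le_card_lastTwoLevels {n : ℕ} (hn : 1 ≤ n) {S : Finset ℕ}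
    (hS : IsDomSetOn (hyperTree n) (treeVerts n) S) :
    2 ^ (n - 1) ≤ (S ∩ Finset.Icc (2 ^ (n - 1)) (2 ^ (n + 1) - 1)).card := by
  have hpow : 2 ^ n = 2 * 2 ^ (n - 1) := by rw [← pow_succ', Nat.sub_add_cancel hn]
  have hpow' : 2 ^ (n + 1) = 2 * 2 ^ n := pow_succ' 2 n
  have hpos : 0 < 2 ^ (n - 1) := by positivity
  have hcover : Finset.Ico (2 ^ n) (2 ^ (n + 1)) ⊆
      (S ∩ Finset.Icc (2 ^ (n - 1)) (2 ^ (n + 1) - 1)).biUnion (bottomDominated n) := by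
    intro v hv
    rw [Finset.mem_Ico] at hv
    simp only [Finset.mem_biUnion, Finset.mem_inter, Finset.mem_Icc]
    by_cases hvS : v ∈ S
    · exact ⟨v, ⟨hvS, by omega, by omega⟩, self_mem_bottomDominated hv.1⟩
    · obtain ⟨u, huS, huv⟩ := hS.2 v (Finset.mem_Icc.2 ⟨by omega, by omega⟩) hvS
      obtain ⟨hu, hmem⟩ := mem_bottomDominated_of_adj hn hv.1 huv
      exact ⟨u, ⟨huS, hu, (Finset.mem_Icc.1 (hS.1 huS)).2⟩, hmem⟩
  have hcard := (Finset.card_le_card hcover).trans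
    (Finset.card_biUnion_le_card_mul _ _ 2 fun u _ => card_bottomDominated_le n u)
  rw [Nat.card_Ico] at hcard
  omega

/-- Any minimum dominating set of the hypertree `HT(n)`, `n ≥ 1`, contains at least
`2^(n-1)` vertices from levels `n-1` and `n`. -/
theorem minDomSet_hyperTree_lastTwoLevels (n : ℕ) (hn : 1 ≤ n) (S : Finset ℕ)
    (hS : IsDomSetOn (hyperTree n) (treeVerts n) S)
    (hmin : S.card = domNum (hyperTree n) (treeVerts n)) :
    2 ^ (n - 1) ≤ (S ∩ Finset.Icc (2 ^ (n - 1)) (2 ^ (n + 1) - 1)).card :=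
  hS.two_pow_le_card_lastTwoLevels hn
end

section
/- Let G be the hypertree HT(n) with n ≥ 1. Then the domination number of G is γ(G) = (2^{n+2}+3)/7 if n ≡ 0 (mod 3), γ(G) = (2^{n+2}-1)/7 if n ≡ 1 (mod 3), and γ(G) = 2(2^{n+1}-1)/7 if n ≡ 2 (mod 3). -/
theorem mem_treeVerts {n x : ℕ} : x ∈ treeVerts n ↔ 1 ≤ x ∧ x < 2 ^ (n + 1) := by
  have := Nat.two_pow_pos (n + 1)
  simp only [treeVerts, Finset.mem_Icc]
  omega

theorem le_level_of_two_pow_le {i k x : ℕ} (h₁ : 2 ^ i ≤ x) (h₂ : x < 2 ^ (k + 1)) : i ≤ k :=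
  Nat.lt_succ_iff.mp ((Nat.pow_lt_pow_iff_right one_lt_two).mp (h₁.trans_lt h₂))

theorem hyperTree_adj_cases {n u v : ℕ} (h : (hyperTree n).Adj u v) :
    v = 2 * u ∨ v = 2 * u + 1 ∨ u = 2 * v ∨ u = 2 * v + 1 ∨
      ∃ i, 1 ≤ i ∧ 2 ^ i ≤ u ∧ u < 2 ^ (i + 1) ∧ 2 ^ i ≤ v ∧ v < 2 ^ (i + 1) ∧
        (v = u + 2 ^ (i - 1) ∨ u = v + 2 ^ (i - 1)) := by
  simp only [hyperTree, SimpleGraph.fromRel_adj] at h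
  grind

theorem hyperTree_adj_of_child {n u v : ℕ} (hu : u ∈ treeVerts n) (hv : v ∈ treeVerts n)
    (h : v = 2 * u ∨ v = 2 * u + 1) : (hyperTree n).Adj u v := by
  have := (mem_treeVerts.mp hu).1
  simp only [hyperTree, SimpleGraph.fromRel_adj]
  exact ⟨by omega, .inl ⟨hu, hv, by tauto⟩⟩

theorem hyperTree_mono {n m : ℕ} (h : n ≤ m) : hyperTree n ≤ hyperTree m := by
  have hV : ∀ x, x ∈ treeVerts n → x ∈ treeVerts m := fun x hx ↦ by
    rw [mem_treeVerts] at hx ⊢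
    exact ⟨hx.1, hx.2.trans_le (Nat.pow_le_pow_right two_pos (by omega))⟩
  intro u v huv
  simp only [hyperTree, SimpleGraph.fromRel_adj] at huv ⊢
  grind

theorem hyperTree_adj_restrict {n m u v : ℕ} (huv : (hyperTree m).Adj u v)
    (hu : u < 2 ^ (n + 1)) (hv : v < 2 ^ (n + 1)) : (hyperTree n).Adj u v := by
  simp only [hyperTree, SimpleGraph.fromRel_adj, mem_treeVerts] at huv ⊢
  have hi : ∀ i, 2 ^ i ≤ u → i ≤ n := fun i hi ↦ le_level_of_two_pow_le hi hu
  have hj : ∀ i, 2 ^ i ≤ v → i ≤ n := fun i hi ↦ le_level_of_two_pow_le hi hv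
  grind

theorem IsDomSetOn.two_pow_le_card_filter {n : ℕ} {S : Finset ℕ}
    (hS : IsDomSetOn (hyperTree (n + 1)) (treeVerts (n + 1)) S) :
    2 ^ n ≤ (S.filter (2 ^ n ≤ ·)).card := by
  let D : ℕ → Finset ℕ := fun u ↦
    if u < 2 ^ (n + 1) then {2 * u, 2 * u + 1}
    else if u < 2 ^ (n + 1) + 2 ^ n then {u, u + 2 ^ n} else {u, u - 2 ^ n}
  have hD : ∀ u ∈ S.filter (2 ^ n ≤ ·), (D u).card ≤ 2 := fun u _ ↦ by
    simp only [D]; split_ifs <;> exact Finset.card_le_two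
  have hcover : Finset.Ico (2 ^ (n + 1)) (2 ^ (n + 2)) ⊆ (S.filter (2 ^ n ≤ ·)).biUnion D := by
    intro v hv
    rw [Finset.mem_Ico] at hv
    have e₁ : 2 ^ (n + 1) = 2 * 2 ^ n := by ring
    have e₂ : 2 ^ (n + 2) = 4 * 2 ^ n := by ring
    have hp := Nat.two_pow_pos n
    simp only [Finset.mem_biUnion, Finset.mem_filter]
    by_cases hvS : v ∈ S
    · refine ⟨v, ⟨hvS, by omega⟩, ?_⟩
      simp only [D, if_neg (not_lt.mpr hv.1)]
      split_ifs <;> simp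
    · obtain ⟨u, huS, huv⟩ := hS.2 v (mem_treeVerts.mpr ⟨by omega, hv.2⟩) hvS
      have hu : u < 2 ^ (n + 2) := (mem_treeVerts.mp (hS.1 huS)).2
      have key : 2 ^ n ≤ u ∧ v ∈ D u := by
        rcases hyperTree_adj_cases huv with h | h | h | h | ⟨i, h1, h2, h3, h4, h5, h6⟩
        · exact ⟨by omega, by simp only [D]; rw [if_pos (by omega)]; simp [h]⟩
        · exact ⟨by omega, by simp only [D]; rw [if_pos (by omega)]; simp [h]⟩
        · omega
        · omega
        · have hi : i = n + 1 := le_antisymm (le_level_of_two_pow_le h4 hv.2)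
            (le_level_of_two_pow_le hv.1 h5)
          subst hi
          rw [Nat.add_sub_cancel] at h6
          refine ⟨by omega, ?_⟩
          simp only [D]
          split_ifs <;> simp only [Finset.mem_insert, Finset.mem_singleton] <;> omega
      exact ⟨u, ⟨huS, key.1⟩, key.2⟩
  have h := (Finset.card_le_card hcover).trans (Finset.card_biUnion_le_card_mul _ _ _ hD)
  rw [Nat.card_Ico, pow_succ, pow_succ] at h
  omega

/-- Pushing the level just below `HT(n)` up to its parents turns a dominating set of a larger
hypertree into one of `HT(n)`. -/
theorem IsDomSetOn.exists_restrict {n m : ℕ} {S : Finset ℕ} (hnm : n ≤ m)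
    (hS : IsDomSetOn (hyperTree m) (treeVerts m) S) :
    ∃ T, IsDomSetOn (hyperTree n) (treeVerts n) T ∧
      T.card ≤ (S.filter (· < 2 ^ (n + 2))).card := by
  have hp := Nat.two_pow_pos n
  have e₁ : 2 ^ (n + 1) = 2 * 2 ^ n := by ring
  have e₂ : 2 ^ (n + 2) = 4 * 2 ^ n := by ring
  refine ⟨(S.filter (· < 2 ^ (n + 2))).image (fun x ↦ if x < 2 ^ (n + 1) then x else x / 2),
    ⟨?_, ?_⟩, Finset.card_image_le⟩
  · intro y hy
    obtain ⟨x, hx, rfl⟩ := Finset.mem_image.mp hy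
    rw [Finset.mem_filter] at hx
    have := (mem_treeVerts.mp (hS.1 hx.1)).1
    rw [mem_treeVerts]
    split_ifs <;> omega
  · intro v hv hvT
    have hv' := mem_treeVerts.mp hv
    have hmem : ∀ x ∈ S, x < 2 ^ (n + 1) → x ∈ (S.filter (· < 2 ^ (n + 2))).image
        (fun x ↦ if x < 2 ^ (n + 1) then x else x / 2) := fun x hx hlt ↦
      Finset.mem_image.mpr ⟨x, Finset.mem_filter.mpr ⟨hx, by omega⟩, if_pos hlt⟩
    have hvm : v ∈ treeVerts m := mem_treeVerts.mpr
      ⟨hv'.1, hv'.2.trans_le (Nat.pow_le_pow_right two_pos (by omega))⟩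
    obtain ⟨u, huS, huv⟩ := hS.2 v hvm fun h ↦ hvT (hmem v h hv'.2)
    by_cases hu : u < 2 ^ (n + 1)
    · exact ⟨u, hmem u huS hu, hyperTree_adj_restrict huv hu hv'.2⟩
    · refine absurd ?_ hvT
      have key : u = 2 * v ∨ u = 2 * v + 1 := by
        rcases hyperTree_adj_cases huv with h | h | h | h | ⟨i, h1, h2, h3, h4, h5, h6⟩
        · omega
        · omega
        · exact .inl h
        · exact .inr h
        · have := Nat.pow_le_pow_right two_pos
            (Nat.succ_le_succ (le_level_of_two_pow_le h4 hv'.2))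
          omega
      refine Finset.mem_image.mpr ⟨u, Finset.mem_filter.mpr ⟨huS, by omega⟩, ?_⟩
      rw [if_neg hu]
      omega

/-- Taking the whole penultimate level dominates the three lowest levels. -/
theorem IsDomSetOn.union_level {n : ℕ} {S : Finset ℕ}
    (hS : IsDomSetOn (hyperTree n) (treeVerts n) S) :
    IsDomSetOn (hyperTree (n + 3)) (treeVerts (n + 3))
      (S ∪ Finset.Ico (2 ^ (n + 2)) (2 ^ (n + 3))) := by
  have hp := Nat.two_pow_pos n
  have e₁ : 2 ^ (n + 1) = 2 * 2 ^ n := by ring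
  have e₂ : 2 ^ (n + 2) = 4 * 2 ^ n := by ring
  have e₃ : 2 ^ (n + 3) = 8 * 2 ^ n := by ring
  have e₄ : 2 ^ (n + 3 + 1) = 16 * 2 ^ n := by ring
  constructor
  · intro x hx
    rw [mem_treeVerts]
    rcases Finset.mem_union.mp hx with h | h
    · have := mem_treeVerts.mp (hS.1 h)
      omega
    · rw [Finset.mem_Ico] at h
      omega
  · intro v hv hvS
    have hv' := mem_treeVerts.mp hv
    simp only [Finset.mem_union, Finset.mem_Ico, not_or] at hvS ⊢
    by_cases h₁ : v < 2 ^ (n + 1)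
    · obtain ⟨u, hu, huv⟩ := hS.2 v (mem_treeVerts.mpr ⟨hv'.1, h₁⟩) hvS.1
      exact ⟨u, .inl hu, hyperTree_mono (by omega) huv⟩
    by_cases h₂ : v < 2 ^ (n + 2)
    · exact ⟨2 * v, .inr (by omega),
        (hyperTree_adj_of_child hv (mem_treeVerts.mpr (by omega)) (.inl rfl)).symm⟩
    · exact ⟨v / 2, .inr (by omega),
        hyperTree_adj_of_child (mem_treeVerts.mpr (by omega)) hv (by omega)⟩

theorem exists_isDomSetOn_card_eq_domNum (G : SimpleGraph ℕ) (V : Finset ℕ) :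
    ∃ S, IsDomSetOn G V S ∧ S.card = domNum G V :=
  Nat.sInf_mem (s := {k | ∃ S : Finset ℕ, IsDomSetOn G V S ∧ S.card = k})
    ⟨V.card, V, ⟨subset_rfl, fun _ h h' ↦ absurd h h'⟩, rfl⟩

theorem IsDomSetOn.domNum_le {G : SimpleGraph ℕ} {V S : Finset ℕ} (hS : IsDomSetOn G V S) :
    domNum G V ≤ S.card :=
  Nat.sInf_le ⟨S, hS, rfl⟩

theorem domNum_eq_of_le_of_ge {G : SimpleGraph ℕ} {V : Finset ℕ} {k : ℕ}
    (hle : ∃ S, IsDomSetOn G V S ∧ S.card ≤ k) (hge : ∀ S, IsDomSetOn G V S → k ≤ S.card) :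
    domNum G V = k := by
  obtain ⟨S, hS, hSk⟩ := hle
  obtain ⟨T, hT, hTc⟩ := exists_isDomSetOn_card_eq_domNum G V
  exact le_antisymm (hS.domNum_le.trans hSk) (hTc ▸ hge T hT)

theorem domNum_hyperTree_add_three (n : ℕ) :
    domNum (hyperTree (n + 3)) (treeVerts (n + 3)) =
      domNum (hyperTree n) (treeVerts n) + 2 ^ (n + 2) := by
  refine domNum_eq_of_le_of_ge ?_ fun S hS ↦ ?_
  · obtain ⟨S, hS, hc⟩ := exists_isDomSetOn_card_eq_domNum (hyperTree n) (treeVerts n)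
    refine ⟨_, hS.union_level, (Finset.card_union_le _ _).trans ?_⟩
    rw [hc, Nat.card_Ico, pow_succ 2 (n + 2)]
    omega
  · obtain ⟨T, hT, hTc⟩ := hS.exists_restrict (n := n) (by omega)
    have h₁ := hT.domNum_le
    have h₂ := IsDomSetOn.two_pow_le_card_filter hS
    have h₃ := Finset.card_filter_add_card_filter_not (s := S) (· < 2 ^ (n + 2))
    simp only [not_lt] at h₃
    omega

theorem domNum_hyperTree_zero : domNum (hyperTree 0) (treeVerts 0) = 1 := by
  refine domNum_eq_of_le_of_ge ⟨{1}, ⟨by simp [treeVerts], ?_⟩, by simp⟩ fun S hS ↦ ?_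
  · intro v hv hv'
    simp_all [treeVerts]
  · rw [Nat.one_le_iff_ne_zero, Finset.card_ne_zero]
    by_cases h : 1 ∈ S
    · exact ⟨1, h⟩
    · obtain ⟨u, hu, -⟩ := hS.2 1 (by simp [treeVerts]) h
      exact ⟨u, hu⟩

theorem domNum_hyperTree_one : domNum (hyperTree 1) (treeVerts 1) = 1 := by
  refine domNum_eq_of_le_of_ge ⟨{1}, ⟨by simp [treeVerts], fun v hv hv' ↦ ?_⟩, by simp⟩ fun S hS ↦
    (IsDomSetOn.two_pow_le_card_filter hS).trans (Finset.card_filter_le _ _)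
  have := mem_treeVerts.mp hv
  rw [Finset.mem_singleton] at hv'
  exact ⟨1, by simp, hyperTree_adj_of_child (mem_treeVerts.mpr (by simp)) hv (by omega)⟩

theorem domNum_hyperTree_two : domNum (hyperTree 2) (treeVerts 2) = 2 := by
  refine domNum_eq_of_le_of_ge ⟨{2, 3}, ⟨by decide, fun v hv hv' ↦ ?_⟩, by simp⟩ fun S hS ↦
    (IsDomSetOn.two_pow_le_card_filter hS).trans (Finset.card_filter_le _ _)
  have := mem_treeVerts.mp hv
  simp only [Finset.mem_insert, Finset.mem_singleton] at hv' ⊢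
  rcases eq_or_ne v 1 with rfl | h
  · exact ⟨2, .inl rfl,
      (hyperTree_adj_of_child hv (mem_treeVerts.mpr (by simp)) (.inl rfl)).symm⟩
  · exact ⟨v / 2, by omega,
      hyperTree_adj_of_child (mem_treeVerts.mpr (by omega)) hv (by omega)⟩

theorem seven_mul_domNum_hyperTree (n : ℕ) :
    7 * domNum (hyperTree n) (treeVerts n) + n % 3 =
      2 ^ (n + 2) + (if n % 3 = 0 then 3 else 0) := by
  induction n using Nat.strong_induction_on with
  | _ n ih =>
    match n with
    | 0 => simp [domNum_hyperTree_zero]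
    | 1 => simp [domNum_hyperTree_one]
    | 2 => simp [domNum_hyperTree_two]
    | n + 3 =>
      have h := ih n (by omega)
      have e : 2 ^ (n + 3 + 2) = 8 * 2 ^ (n + 2) := by ring
      rw [domNum_hyperTree_add_three, e, Nat.add_mod_right]
      omega

/-- The domination number of the hypertree `HT(n)`, `n ≥ 1`. -/
theorem domNum_hyperTree (n : ℕ) (hn : 1 ≤ n) :
    (n % 3 = 0 → domNum (hyperTree n) (treeVerts n) = (2 ^ (n + 2) + 3) / 7) ∧
    (n % 3 = 1 → domNum (hyperTree n) (treeVerts n) = (2 ^ (n + 2) - 1) / 7) ∧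
    (n % 3 = 2 → domNum (hyperTree n) (treeVerts n) = 2 * (2 ^ (n + 1) - 1) / 7) := by
  have h := seven_mul_domNum_hyperTree n
  have e : 2 ^ (n + 2) = 2 * 2 ^ (n + 1) := by ring
  refine ⟨fun h3 ↦ ?_, fun h3 ↦ ?_, fun h3 ↦ ?_⟩ <;> simp [h3] at h <;> omega
end

section
/- Let G be the root-fault hypertree HT*(3). Then the locating-domination number γ^L(G) = 6 and the locating-total domination number γ^L_t(G) = 6. -/
/-- The upward-oriented edge relation of `HT(3)`, without range restrictions on labels. -/
def threeEdge (x y : ℕ) : Prop :=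
  y = 2 * x ∨ y = 2 * x + 1 ∨
    (x = 2 ∧ y = 3) ∨ (4 ≤ x ∧ y < 8 ∧ y = x + 2) ∨ (8 ≤ x ∧ y < 16 ∧ y = x + 4)

instance : DecidableRel threeEdge := fun x y => by unfold threeEdge; infer_instance

/-- The neighbourhood of `v` in the root-fault hypertree `HT*(3)`, as a finset. -/
def rootFaultNbr (v : ℕ) : Finset ℕ :=
  (Finset.Icc 2 15).filter fun u => v ∈ Finset.Icc 2 15 ∧ (threeEdge u v ∨ threeEdge v u)

lemma exists_level_three_iff (x y : ℕ) :
    (∃ i, 1 ≤ i ∧ i ≤ 3 ∧ 2 ^ i ≤ x ∧ x < 2 ^ (i + 1) ∧ 2 ^ i ≤ y ∧ y < 2 ^ (i + 1) ∧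
      y = x + 2 ^ (i - 1)) ↔
      (x = 2 ∧ y = 3) ∨ (4 ≤ x ∧ y < 8 ∧ y = x + 2) ∨ (8 ≤ x ∧ y < 16 ∧ y = x + 4) := by
  constructor
  · rintro ⟨i, h1, h3, h⟩
    interval_cases i <;> norm_num at h <;> omega
  · rintro (h | h | h)
    · exact ⟨1, by norm_num; omega⟩
    · exact ⟨2, by norm_num; omega⟩
    · exact ⟨3, by norm_num; omega⟩

lemma hyperTree_three_adj_iff (u v : ℕ) :
    (hyperTree 3).Adj u v ↔
      u ∈ Finset.Icc 1 15 ∧ v ∈ Finset.Icc 1 15 ∧ (threeEdge u v ∨ threeEdge v u) := by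
  have ne {x y : ℕ} (hx : x ∈ Finset.Icc 1 15) (h : threeEdge x y) : x ≠ y := by
    rw [Finset.mem_Icc] at hx
    unfold threeEdge at h
    omega
  have hT : treeVerts 3 = Finset.Icc 1 15 := rfl
  simp only [hyperTree, SimpleGraph.fromRel_adj, exists_level_three_iff, hT]
  constructor
  · rintro ⟨-, ⟨hu, hv, h⟩ | ⟨hv, hu, h⟩⟩
    · exact ⟨hu, hv, .inl h⟩
    · exact ⟨hu, hv, .inr h⟩
  · rintro ⟨hu, hv, h | h⟩
    · exact ⟨ne hu h, .inl ⟨hu, hv, h⟩⟩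
    · exact ⟨(ne hv h).symm, .inr ⟨hv, hu, h⟩⟩

lemma rootFaultHyperTree_three_adj_iff (u v : ℕ) :
    (rootFaultHyperTree 3).Adj u v ↔ u ∈ rootFaultNbr v := by
  have hadj : (rootFaultHyperTree 3).Adj u v ↔ u ≠ 1 ∧ v ≠ 1 ∧ (hyperTree 3).Adj u v := by
    rw [rootFaultHyperTree, SimpleGraph.fromRel_adj]
    constructor
    · rintro ⟨-, h | ⟨hv, hu, h⟩⟩
      · exact h
      · exact ⟨hu, hv, h.symm⟩
    · exact fun h => ⟨h.2.2.ne, .inl h⟩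
  have hI (x : ℕ) : x ∈ Finset.Icc 2 15 ↔ x ≠ 1 ∧ x ∈ Finset.Icc 1 15 := by
    simp only [Finset.mem_Icc]
    omega
  rw [hadj, hyperTree_three_adj_iff, rootFaultNbr, Finset.mem_filter, hI, hI]
  tauto

lemma LocatesOn.exists_mem_symmDiff {V S : Finset ℕ} (h : LocatesOn (rootFaultHyperTree 3) V S)
    {u v : ℕ} (hu : u ∈ V) (hv : v ∈ V) (huv : u ≠ v) :
    u ∈ S ∨ v ∈ S ∨ ∃ w ∈ symmDiff (rootFaultNbr u) (rootFaultNbr v), w ∈ S := by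
  by_contra! hc
  refine h u hu v hv hc.1 hc.2.1 huv (Set.ext fun w => and_congr_right fun hw => ?_)
  have := fun hm => hc.2.2 w hm hw
  simp only [Finset.mem_symmDiff] at this
  rw [rootFaultHyperTree_three_adj_iff, rootFaultHyperTree_three_adj_iff]
  tauto

lemma IsDomSetOn.exists_mem_rootFaultNbr {V S : Finset ℕ}
    (h : IsDomSetOn (rootFaultHyperTree 3) V S) {v : ℕ} (hv : v ∈ V) :
    v ∈ S ∨ ∃ w ∈ rootFaultNbr v, w ∈ S := by
  by_cases hS : v ∈ S
  · exact .inl hS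
  · obtain ⟨u, hu, ha⟩ := h.2 v hv hS
    exact .inr ⟨u, (rootFaultHyperTree_three_adj_iff u v).1 ha, hu⟩

/-- Local lower bound on the six-vertex subtree pair `a, b` (adjacent, with respective parents
`x, y`), `c, d` (the children of `a`) and `e, f` (the children of `b`), with `c ~ e`, `d ~ f`. -/
lemma rootFault_block_bound : ∀ a b c d e f x y : Bool,
    (a || x || c || d || b) → (b || y || e || f || a) →
    (c || a || e) → (d || a || f) → (e || b || c) → (f || b || d) →
    (c || d || e || f) →
    (a || e || x || d) → (a || f || x || c) → (b || c || y || f) → (b || d || y || e) →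
    2 ≤ a.toNat + b.toNat + c.toNat + d.toNat + e.toNat + f.toNat ∧
    (a.toNat + b.toNat + c.toNat + d.toNat + e.toNat + f.toNat = 2 →
      (x || y) ∧ (x = false → !(a || b || e || f)) ∧ (y = false → !(a || b || c || d))) := by
  decide

lemma IsLocDomSetOn.six_le_card {S : Finset ℕ}
    (h : IsLocDomSetOn (rootFaultHyperTree 3) (rootFaultVerts 3) S) : 6 ≤ S.card := by
  obtain ⟨hd, hl⟩ := h
  have hV : rootFaultVerts 3 = {2, 3, 4, 5, 6, 7, 8, 9, 10, 11, 12, 13, 14, 15} := by decide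
  have dom (v : ℕ) (T : Finset ℕ) (hv : v ∈ rootFaultVerts 3) (hT : rootFaultNbr v = T) :
      v ∈ S ∨ ∃ w ∈ T, w ∈ S := hT ▸ hd.exists_mem_rootFaultNbr hv
  have sep (u v : ℕ) (T : Finset ℕ) (hu : u ∈ rootFaultVerts 3) (hv : v ∈ rootFaultVerts 3)
      (huv : u ≠ v) (hT : symmDiff (rootFaultNbr u) (rootFaultNbr v) = T) :
      u ∈ S ∨ v ∈ S ∨ ∃ w ∈ T, w ∈ S := hT ▸ hl.exists_mem_symmDiff hu hv huv
  have hcard : S.card = ∑ v ∈ rootFaultVerts 3, (decide (v ∈ S)).toNat := by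
    rw [← Finset.inter_eq_right.2 hd.1, ← Finset.filter_mem_eq_inter, Finset.card_filter]
    exact Finset.sum_congr rfl fun v hv => by by_cases hS : v ∈ S <;> simp [hS, hv]
  rw [hV] at hcard
  replace hcard : S.card = (decide (2 ∈ S)).toNat + (decide (3 ∈ S)).toNat +
      ((decide (4 ∈ S)).toNat + (decide (6 ∈ S)).toNat + (decide (8 ∈ S)).toNat +
        (decide (9 ∈ S)).toNat + (decide (12 ∈ S)).toNat + (decide (13 ∈ S)).toNat) +
      ((decide (5 ∈ S)).toNat + (decide (7 ∈ S)).toNat + (decide (10 ∈ S)).toNat +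
        (decide (11 ∈ S)).toNat + (decide (14 ∈ S)).toNat + (decide (15 ∈ S)).toNat) := by
    rw [hcard]
    simp only [Finset.sum_insert, Finset.mem_insert, Finset.mem_singleton, Finset.sum_singleton,
      Nat.reduceEqDiff, or_self, not_false_eq_true]
    ring
  have block (a b c d e f : ℕ)
      (ha : a ∈ rootFaultVerts 3) (hb : b ∈ rootFaultVerts 3) (hc : c ∈ rootFaultVerts 3)
      (hd : d ∈ rootFaultVerts 3) (he : e ∈ rootFaultVerts 3) (hf : f ∈ rootFaultVerts 3)
      (na : rootFaultNbr a = {2, c, d, b}) (nb : rootFaultNbr b = {3, e, f, a})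
      (nc : rootFaultNbr c = {a, e}) (nd : rootFaultNbr d = {a, f})
      (ne : rootFaultNbr e = {b, c}) (nf : rootFaultNbr f = {b, d})
      (hn : [a, b, c, d, e, f].Nodup)
      (scd : symmDiff (rootFaultNbr c) (rootFaultNbr d) = {e, f})
      (sae : symmDiff (rootFaultNbr a) (rootFaultNbr e) = {2, d})
      (saf : symmDiff (rootFaultNbr a) (rootFaultNbr f) = {2, c})
      (sbc : symmDiff (rootFaultNbr b) (rootFaultNbr c) = {3, f})
      (sbd : symmDiff (rootFaultNbr b) (rootFaultNbr d) = {3, e}) :=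
    rootFault_block_bound (decide (a ∈ S)) (decide (b ∈ S)) (decide (c ∈ S)) (decide (d ∈ S))
      (decide (e ∈ S)) (decide (f ∈ S)) (decide (2 ∈ S)) (decide (3 ∈ S))
      (by simpa [or_assoc] using dom a _ ha na) (by simpa [or_assoc] using dom b _ hb nb)
      (by simpa [or_assoc] using dom c _ hc nc) (by simpa [or_assoc] using dom d _ hd nd)
      (by simpa [or_assoc] using dom e _ he ne) (by simpa [or_assoc] using dom f _ hf nf)
      (by simpa [or_assoc] using sep c d _ hc hd (by simp at hn; tauto) scd)
      (by simpa [or_assoc] using sep a e _ ha he (by simp at hn; tauto) sae)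
      (by simpa [or_assoc] using sep a f _ ha hf (by simp at hn; tauto) saf)
      (by simpa [or_assoc] using sep b c _ hb hc (by simp at hn; tauto) sbc)
      (by simpa [or_assoc] using sep b d _ hb hd (by simp at hn; tauto) sbd)
  have left := block 4 6 8 9 12 13 (by decide) (by decide) (by decide) (by decide) (by decide)
    (by decide) (by decide) (by decide) (by decide) (by decide) (by decide) (by decide)
    (by decide) (by decide) (by decide) (by decide) (by decide) (by decide)
  have right := block 5 7 10 11 14 15 (by decide) (by decide) (by decide) (by decide) (by decide)
    (by decide) (by decide) (by decide) (by decide) (by decide) (by decide) (by decide)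
    (by decide) (by decide) (by decide) (by decide) (by decide) (by decide)
  have sep_four_five : 4 ∈ S ∨ 5 ∈ S ∨ 6 ∈ S ∨ 7 ∈ S ∨ 8 ∈ S ∨ 9 ∈ S ∨ 10 ∈ S ∨ 11 ∈ S := by
    simpa using sep 4 5 {6, 7, 8, 9, 10, 11} (by decide) (by decide) (by decide) (by decide)
  have sep_six_seven : 6 ∈ S ∨ 7 ∈ S ∨ 4 ∈ S ∨ 5 ∈ S ∨ 12 ∈ S ∨ 13 ∈ S ∨ 14 ∈ S ∨ 15 ∈ S := by
    simpa using sep 6 7 {4, 5, 12, 13, 14, 15} (by decide) (by decide) (by decide) (by decide)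
  clear block dom sep hl hd hV
  generalize (decide (4 ∈ S)).toNat + _ + _ + _ + _ + _ = L at hcard left
  generalize (decide (5 ∈ S)).toNat + _ + _ + _ + _ + _ = R at hcard right
  by_contra! hlt
  obtain ⟨l2, l⟩ := left
  obtain ⟨r2, r⟩ := right
  by_cases h2 : 2 ∈ S <;> by_cases h3 : 3 ∈ S <;> simp [h2, h3] at l r hcard
  · omega
  · simp [l (by omega), r (by omega)] at sep_four_five
  · simp [l (by omega), r (by omega)] at sep_six_seven
  · omega

lemma exists_isLocTotalDomSetOn_card_six :
    ∃ S, IsLocTotalDomSetOn (rootFaultHyperTree 3) (rootFaultVerts 3) S ∧ S.card = 6 := by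
  obtain ⟨S, hV, hd, hl, hcard⟩ : ∃ S ⊆ rootFaultVerts 3,
      (∀ v ∈ rootFaultVerts 3, ∃ u ∈ S, u ∈ rootFaultNbr v) ∧
      (∀ u ∈ rootFaultVerts 3, ∀ v ∈ rootFaultVerts 3, u ∉ S → v ∉ S → u ≠ v →
        ∃ w ∈ S, ¬ (w ∈ rootFaultNbr u ↔ w ∈ rootFaultNbr v)) ∧ S.card = 6 :=
    ⟨{4, 5, 6, 7, 8, 10}, by decide +kernel⟩
  refine ⟨S, ⟨⟨hV, ?_⟩, ?_⟩, hcard⟩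
  · simpa only [rootFaultHyperTree_three_adj_iff] using hd
  · intro u hu v hv hus hvs huv heq
    obtain ⟨w, hw, hn⟩ := hl u hu v hv hus hvs huv
    have := Set.ext_iff.1 heq w
    simp only [Set.mem_ofPred_eq, hw, true_and, rootFaultHyperTree_three_adj_iff] at this
    exact hn this

lemma IsLocTotalDomSetOn.isLocDomSetOn {G : SimpleGraph ℕ} {V S : Finset ℕ}
    (h : IsLocTotalDomSetOn G V S) : IsLocDomSetOn G V S :=
  ⟨⟨h.1.1, fun v hv _ => h.1.2 v hv⟩, h.2⟩

/-- The root-fault hypertree `HT*(3)` has locating-domination number 6 and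
locating-total domination number 6. -/
theorem locDom_and_locTotalDom_rootFaultHyperTree_three :
    locDomNum (rootFaultHyperTree 3) (rootFaultVerts 3) = 6 ∧
    locTotalDomNum (rootFaultHyperTree 3) (rootFaultVerts 3) = 6 := by
  obtain ⟨S, hS, hcard⟩ := exists_isLocTotalDomSetOn_card_six
  constructor
  · refine IsLeast.csInf_eq ⟨⟨S, hS.isLocDomSetOn, hcard⟩, ?_⟩
    rintro _ ⟨T, hT, rfl⟩
    exact hT.six_le_card
  · refine IsLeast.csInf_eq ⟨⟨S, hS, hcard⟩, ?_⟩
    rintro _ ⟨T, hT, rfl⟩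
    exact hT.isLocDomSetOn.six_le_card
end

section
/- Let G be the hypertree HT(n) with n ≥ 1. Then the locating-domination number of G is γ^L(G) = (2^{n+2}+1)/5 if n ≡ 0 (mod 4), γ^L(G) = (2^{n+2}+2)/5 if n ≡ 1 (mod 4), γ^L(G) = (2^{n+2}-1)/5 if n ≡ 2 (mod 4), and γ^L(G) = (2^{n+2}-2)/5 if n ≡ 3 (mod 4). -/
namespace HyperTree

lemma level_unique {x i j : ℕ} (hi : 2 ^ i ≤ x) (hi' : x < 2 ^ (i + 1))
    (hj : 2 ^ j ≤ x) (hj' : x < 2 ^ (j + 1)) : i = j := by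
  have h1 := (Nat.pow_lt_pow_iff_right (a := 2) (by norm_num)).1 (hi.trans_lt hj')
  have h2 := (Nat.pow_lt_pow_iff_right (a := 2) (by norm_num)).1 (hj.trans_lt hi')
  omega

lemma mem_treeVerts {n x : ℕ} : x ∈ treeVerts n ↔ 1 ≤ x ∧ x < 2 ^ (n + 1) := by
  have := Nat.two_pow_pos (n + 1)
  simp only [treeVerts, Finset.mem_Icc]
  omega

lemma adj_iff {n x y : ℕ} : (hyperTree n).Adj x y ↔
    x ∈ treeVerts n ∧ y ∈ treeVerts n ∧ x ≠ y ∧ (y = 2 * x ∨ y = 2 * x + 1 ∨ x = 2 * y ∨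
      x = 2 * y + 1 ∨ ∃ j, j + 1 ≤ n ∧ 2 * 2 ^ j ≤ x ∧ x < 4 * 2 ^ j ∧ 2 * 2 ^ j ≤ y ∧
        y < 4 * 2 ^ j ∧ (y = x + 2 ^ j ∨ x = y + 2 ^ j)) := by
  have key : ∀ x y : ℕ, (∃ i, 1 ≤ i ∧ i ≤ n ∧ 2 ^ i ≤ x ∧ x < 2 ^ (i + 1) ∧ 2 ^ i ≤ y ∧
      y < 2 ^ (i + 1) ∧ y = x + 2 ^ (i - 1)) ↔ ∃ j, j + 1 ≤ n ∧ 2 * 2 ^ j ≤ x ∧ x < 4 * 2 ^ j ∧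
      2 * 2 ^ j ≤ y ∧ y < 4 * 2 ^ j ∧ y = x + 2 ^ j := by
    intro x y
    constructor
    · rintro ⟨i, h1, h⟩
      obtain ⟨j, rfl⟩ : ∃ j, i = j + 1 := ⟨i - 1, by omega⟩
      refine ⟨j, ?_⟩
      simp only [pow_succ, Nat.add_sub_cancel] at h
      omega
    · rintro ⟨j, h⟩
      refine ⟨j + 1, ?_⟩
      simp only [pow_succ, Nat.add_sub_cancel]
      omega
  simp only [hyperTree, SimpleGraph.fromRel_adj, key]
  constructor
  · rintro ⟨hne, ⟨hx, hy, h⟩ | ⟨hy, hx, h⟩⟩ <;> refine ⟨hx, hy, hne, ?_⟩ <;>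
      rcases h with h | h | ⟨j, h⟩
    · exact .inl h
    · exact .inr (.inl h)
    · exact .inr (.inr (.inr (.inr ⟨j, by omega⟩)))
    · exact .inr (.inr (.inl h))
    · exact .inr (.inr (.inr (.inl h)))
    · exact .inr (.inr (.inr (.inr ⟨j, by omega⟩)))
  · rintro ⟨hx, hy, hne, h⟩
    refine ⟨hne, ?_⟩
    rcases h with h | h | h | h | ⟨j, h1, h2, h3, h4, h5, h | h⟩
    · exact .inl ⟨hx, hy, .inl h⟩
    · exact .inl ⟨hx, hy, .inr (.inl h)⟩
    · exact .inr ⟨hy, hx, .inl h⟩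
    · exact .inr ⟨hy, hx, .inr (.inl h)⟩
    · exact .inl ⟨hx, hy, .inr (.inr ⟨j, h1, h2, h3, h4, h5, h⟩)⟩
    · exact .inr ⟨hy, hx, .inr (.inr ⟨j, h1, h4, h5, h2, h3, h⟩)⟩

lemma adj_of_le {N n x y : ℕ} (h : N ≤ n) : (hyperTree N).Adj x y ↔
    (hyperTree n).Adj x y ∧ x ∈ treeVerts N ∧ y ∈ treeVerts N := by
  have hp : 2 ^ (N + 1) ≤ 2 ^ (n + 1) := Nat.pow_le_pow_right (by norm_num) (by omega)
  simp only [adj_iff, mem_treeVerts]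
  constructor
  · rintro ⟨hx, hy, hne, h'⟩
    refine ⟨⟨⟨hx.1, by omega⟩, ⟨hy.1, by omega⟩, hne, ?_⟩, hx, hy⟩
    rcases h' with h' | h' | h' | h' | ⟨j, hj, h'⟩
    · exact .inl h'
    · exact .inr (.inl h')
    · exact .inr (.inr (.inl h'))
    · exact .inr (.inr (.inr (.inl h')))
    · exact .inr (.inr (.inr (.inr ⟨j, by omega, h'⟩)))
  · rintro ⟨⟨-, -, hne, h'⟩, hx, hy⟩
    refine ⟨hx, hy, hne, ?_⟩
    rcases h' with h' | h' | h' | h' | ⟨j, hj, h'⟩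
    · exact .inl h'
    · exact .inr (.inl h')
    · exact .inr (.inr (.inl h'))
    · exact .inr (.inr (.inr (.inl h')))
    · refine .inr (.inr (.inr (.inr ⟨j, ?_, h'⟩)))
      have : 2 ^ (j + 1) < 2 ^ (N + 1) := by rw [pow_succ]; omega
      have := (Nat.pow_lt_pow_iff_right (a := 2) (by norm_num)).1 this
      omega

lemma adj_one {n w : ℕ} : (hyperTree n).Adj w 1 ↔ 1 ≤ n ∧ (w = 2 ∨ w = 3) := by
  rw [adj_iff, mem_treeVerts, mem_treeVerts]
  constructor
  · rintro ⟨h1, h2, h3, h⟩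
    rcases h with h | h | h | h | ⟨j, h⟩
    · omega
    · omega
    all_goals
      have := Nat.two_pow_pos 1
      have := Nat.two_pow_pos n
      try have := Nat.two_pow_pos j
    · refine ⟨?_, by omega⟩
      by_contra hn
      obtain rfl : n = 0 := by omega
      omega
    · refine ⟨?_, by omega⟩
      by_contra hn
      obtain rfl : n = 0 := by omega
      omega
    · omega
  · rintro ⟨h1, h⟩
    have : 2 ^ (1 + 1) ≤ 2 ^ (n + 1) := Nat.pow_le_pow_right (by norm_num) (by omega)
    refine ⟨by omega, by omega, by omega, by omega⟩

/-- The neighbours of a non-root vertex. -/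
lemma adj_nonroot {n j w x : ℕ} (hj : j + 1 ≤ n) (h2 : 2 * 2 ^ j ≤ x) (h4 : x < 4 * 2 ^ j) :
    (hyperTree n).Adj w x ↔ w = x / 2 ∨ (x < 3 * 2 ^ j ∧ w = x + 2 ^ j) ∨
      (3 * 2 ^ j ≤ x ∧ w + 2 ^ j = x) ∨ (j + 1 < n ∧ (w = 2 * x ∨ w = 2 * x + 1)) := by
  have hp := Nat.two_pow_pos j
  have hV : 4 * 2 ^ j ≤ 2 ^ (n + 1) := by
    have : 2 ^ (j + 2) ≤ 2 ^ (n + 1) := Nat.pow_le_pow_right (by norm_num) (by omega)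
    rw [pow_add] at this
    omega
  rw [adj_iff, mem_treeVerts, mem_treeVerts]
  constructor
  · rintro ⟨hw, hx, hne, h⟩
    have child : 2 * x < 2 ^ (n + 1) → j + 1 < n := by
      intro hx2
      have : 2 ^ (j + 2) < 2 ^ (n + 1) := by rw [pow_add]; omega
      have := (Nat.pow_lt_pow_iff_right (a := 2) (by norm_num)).1 this
      omega
    rcases h with h | h | h | h | ⟨i, h⟩
    · omega
    · omega
    · exact .inr (.inr (.inr ⟨child (by omega), .inl h⟩))
    · exact .inr (.inr (.inr ⟨child (by omega), .inr h⟩))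
    · have : i + 1 = j + 1 := level_unique (x := x) (by rw [pow_succ]; omega)
        (by rw [pow_succ, pow_succ]; omega) (by rw [pow_succ]; omega)
        (by rw [pow_succ, pow_succ]; omega)
      obtain rfl : i = j := by omega
      omega
  · rintro (h | h | h | ⟨hn, h⟩)
    · exact ⟨by omega, by omega, by omega, by omega⟩
    · exact ⟨by omega, by omega, by omega, .inr (.inr (.inr (.inr ⟨j, hj, by omega⟩)))⟩
    · exact ⟨by omega, by omega, by omega, .inr (.inr (.inr (.inr ⟨j, hj, by omega⟩)))⟩
    · have hV : 8 * 2 ^ j ≤ 2 ^ (n + 1) := by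
        have : 2 ^ (j + 3) ≤ 2 ^ (n + 1) := Nat.pow_le_pow_right (by norm_num) (by omega)
        rw [pow_add] at this
        omega
      exact ⟨by omega, by omega, by omega, by omega⟩

lemma exists_level {x : ℕ} (hx : 2 ≤ x) : ∃ j, 2 * 2 ^ j ≤ x ∧ x < 4 * 2 ^ j := by
  have h1 := Nat.pow_log_le_self 2 (show x ≠ 0 by omega)
  have h2 := Nat.lt_pow_succ_log_self (b := 2) (by norm_num) x
  have h3 : 1 ≤ Nat.log 2 x := Nat.log_pos (by norm_num) hx
  obtain ⟨j, hj⟩ : ∃ j, Nat.log 2 x = j + 1 := ⟨Nat.log 2 x - 1, by omega⟩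
  rw [hj] at h1 h2
  refine ⟨j, ?_, ?_⟩
  · rw [pow_succ] at h1; omega
  · rw [Nat.succ_eq_add_one, pow_succ, pow_succ] at h2; omega

lemma level_le {n j x : ℕ} (hx : x ∈ treeVerts n) (h : 2 * 2 ^ j ≤ x) : j + 1 ≤ n := by
  rw [mem_treeVerts] at hx
  have : 2 ^ (j + 1) < 2 ^ (n + 1) := by rw [pow_succ]; omega
  have := (Nat.pow_lt_pow_iff_right (a := 2) (by norm_num)).1 this
  omega

lemma isLocDomSetOn_iff {G : SimpleGraph ℕ} {V S : Finset ℕ} : IsLocDomSetOn G V S ↔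
    S ⊆ V ∧ (∀ v ∈ V, v ∉ S → ∃ w ∈ S, G.Adj w v) ∧
      ∀ u ∈ V, ∀ v ∈ V, u ∉ S → v ∉ S → (∀ w ∈ S, G.Adj w u ↔ G.Adj w v) → u = v := by
  unfold IsLocDomSetOn IsDomSetOn LocatesOn
  rw [and_assoc]
  refine and_congr_right fun _ => and_congr_right fun _ => ?_
  refine forall₄_congr fun u _ v _ => forall₂_congr fun _ _ => ?_
  rw [ne_eq, ne_eq, not_imp_not, Set.ext_iff]
  simp only [Set.mem_ofPred_eq, and_congr_right_iff]

/-- The indicator of a finite set of vertices. -/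
def ind (S : Finset ℕ) (x : ℕ) : ℕ := if x ∈ S then 1 else 0

lemma ind_mem {S : Finset ℕ} {x : ℕ} (h : x ∈ S) : ind S x = 1 := if_pos h

lemma ind_notMem {S : Finset ℕ} {x : ℕ} (h : x ∉ S) : ind S x = 0 := if_neg h

lemma card_eq_sum_ind {n : ℕ} {S : Finset ℕ} (hS : S ⊆ treeVerts n) :
    S.card = ∑ x ∈ Finset.Ico 1 (2 ^ (n + 1)), ind S x := by
  have h : S = (Finset.Ico 1 (2 ^ (n + 1))).filter (· ∈ S) := by
    ext x
    simp only [Finset.mem_filter, Finset.mem_Ico]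
    exact ⟨fun h => ⟨mem_treeVerts.1 (hS h), h⟩, fun h => h.2⟩
  conv_lhs => rw [h]
  rw [Finset.card_filter]
  rfl

lemma sum_Ico_double (f : ℕ → ℕ) {a b : ℕ} (h : a ≤ b) :
    ∑ x ∈ Finset.Ico (2 * a) (2 * b), f x = ∑ p ∈ Finset.Ico a b, (f (2 * p) + f (2 * p + 1)) := by
  induction b, h using Nat.le_induction with
  | base => simp
  | succ b hb ih =>
    rw [Finset.sum_Ico_succ_top hb, ← ih, show 2 * (b + 1) = 2 * b + 1 + 1 by ring,
      Finset.sum_Ico_succ_top (by omega), Finset.sum_Ico_succ_top (by omega), add_assoc]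

lemma sum_Ico_pair (f : ℕ → ℕ) (m : ℕ) :
    ∑ x ∈ Finset.Ico (2 * m) (4 * m), f x =
      ∑ q ∈ Finset.Ico (2 * m) (3 * m), (f q + f (q + m)) := by
  rw [← Finset.sum_Ico_consecutive f (show 2 * m ≤ 3 * m by omega) (show 3 * m ≤ 4 * m by omega),
    Finset.sum_add_distrib, Finset.sum_Ico_add', show 2 * m + m = 3 * m by ring,
    show 3 * m + m = 4 * m by ring]

lemma sum_le_levels (f : ℕ → ℕ) (k : ℕ) :
    ∑ x ∈ Finset.Ico 1 (2 ^ (k + 1)), f x =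
      ∑ x ∈ Finset.Ico 1 (2 ^ k), f x + ∑ x ∈ Finset.Ico (2 ^ k) (2 ^ (k + 1)), f x :=
  (Finset.sum_Ico_consecutive f Nat.one_le_two_pow (Nat.pow_le_pow_right (by norm_num)
    (by omega))).symm

lemma ind_le_one (S : Finset ℕ) (x : ℕ) : ind S x ≤ 1 := by
  unfold ind; split <;> omega

lemma ind_eq_one {S : Finset ℕ} {x : ℕ} : x ∈ S ↔ ind S x = 1 := by
  simp [ind]

/-- The number of chosen vertices in the block formed by the adjacent pair `p`, `p'` and their
children. -/
def blockCount (S : Finset ℕ) (p p' : ℕ) : ℕ :=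
  ind S p + ind S p' + ind S (2 * p) + ind S (2 * p + 1) + ind S (2 * p') + ind S (2 * p' + 1)

lemma two_level_bound {j p p' : ℕ} {S : Finset ℕ}
    (hS : IsLocDomSetOn (hyperTree (j + 2)) (treeVerts (j + 2)) S)
    (h2 : 2 * 2 ^ j ≤ p) (h3 : p < 3 * 2 ^ j) (hp' : p' = p + 2 ^ j) :
    2 ≤ blockCount S p p' ∧ (3 ≤ blockCount S p p' ∨ (p / 2 ∈ S ∧ p' / 2 ∈ S) ∨
      (p' / 2 ∈ S ∧ p' ∉ S ∧ p ∉ S ∧ 2 * p' ∉ S ∧ 2 * p' + 1 ∉ S) ∨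
      (p / 2 ∈ S ∧ p ∉ S ∧ p' ∉ S ∧ 2 * p ∉ S ∧ 2 * p + 1 ∉ S)) := by
  have hpos := Nat.two_pow_pos j
  have hj : 2 ^ (j + 1) = 2 * 2 ^ j := by rw [pow_succ]; ring
  have hV : ∀ x, 1 ≤ x → x < 8 * 2 ^ j → x ∈ treeVerts (j + 2) := by
    intro x h h'
    rw [mem_treeVerts, pow_succ, pow_succ, pow_succ]
    omega
  obtain ⟨-, dom, loc⟩ := isLocDomSetOn_iff.1 hS
  have ap (w) : (hyperTree (j + 2)).Adj w p ↔ w = p / 2 ∨ w = p' ∨ w = 2 * p ∨ w = 2 * p + 1 := by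
    rw [adj_nonroot (j := j) (by omega) (by omega) (by omega)]; omega
  have ap' (w) : (hyperTree (j + 2)).Adj w p' ↔
      w = p' / 2 ∨ w = p ∨ w = 2 * p' ∨ w = 2 * p' + 1 := by
    rw [adj_nonroot (j := j) (by omega) (by omega) (by omega)]; omega
  have aa (w) : (hyperTree (j + 2)).Adj w (2 * p) ↔ w = p ∨ w = 2 * p' := by
    rw [adj_nonroot (j := j + 1) (by omega) (by omega) (by omega)]; omega
  have ab (w) : (hyperTree (j + 2)).Adj w (2 * p + 1) ↔ w = p ∨ w = 2 * p' + 1 := by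
    rw [adj_nonroot (j := j + 1) (by omega) (by omega) (by omega)]; omega
  have aa' (w) : (hyperTree (j + 2)).Adj w (2 * p') ↔ w = p' ∨ w = 2 * p := by
    rw [adj_nonroot (j := j + 1) (by omega) (by omega) (by omega)]; omega
  have ab' (w) : (hyperTree (j + 2)).Adj w (2 * p' + 1) ↔ w = p' ∨ w = 2 * p + 1 := by
    rw [adj_nonroot (j := j + 1) (by omega) (by omega) (by omega)]; omega
  have vp := hV p (by omega) (by omega)
  have vp' := hV p' (by omega) (by omega)
  have va := hV (2 * p) (by omega) (by omega)
  have vb := hV (2 * p + 1) (by omega) (by omega)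
  have va' := hV (2 * p') (by omega) (by omega)
  have vb' := hV (2 * p' + 1) (by omega) (by omega)
  have da := dom _ va
  have db := dom _ vb
  have da' := dom _ va'
  have db' := dom _ vb'
  have dp := dom _ vp
  have dp' := dom _ vp'
  have l1 := loc _ va _ vb
  have l2 := loc _ va' _ vb'
  have l3 := loc _ vp _ va'
  have l4 := loc _ vp _ vb'
  have l5 := loc _ vp' _ va
  have l6 := loc _ vp' _ vb
  simp only [aa, ab, aa', ab', ap, ap', and_or_left, exists_or, exists_eq_right]
    at dp dp' da db da' db' l1 l2 l3 l4 l5 l6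
  clear dom loc
  have l1' : 2 * p ∈ S ∨ 2 * p + 1 ∈ S ∨ 2 * p' ∈ S ∨ 2 * p' + 1 ∈ S := by
    by_contra! h
    have := l1 h.1 h.2.1 (by grind)
    omega
  have l3' : p ∈ S ∨ 2 * p' ∈ S ∨ p / 2 ∈ S ∨ 2 * p + 1 ∈ S := by
    by_contra! h
    have := l3 h.1 h.2.1 (by grind)
    omega
  have l4' : p ∈ S ∨ 2 * p' + 1 ∈ S ∨ p / 2 ∈ S ∨ 2 * p ∈ S := by
    by_contra! h
    have := l4 h.1 h.2.1 (by grind)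
    omega
  have l5' : p' ∈ S ∨ 2 * p ∈ S ∨ p' / 2 ∈ S ∨ 2 * p' + 1 ∈ S := by
    by_contra! h
    have := l5 h.1 h.2.1 (by grind)
    omega
  have l6' : p' ∈ S ∨ 2 * p + 1 ∈ S ∨ p' / 2 ∈ S ∨ 2 * p' ∈ S := by
    by_contra! h
    have := l6 h.1 h.2.1 (by grind)
    omega
  clear l1 l2 l3 l4 l5 l6 aa ab aa' ab' ap ap' hV hS
  unfold blockCount ind
  by_cases c1 : p ∈ S <;> by_cases c2 : p' ∈ S <;> by_cases c3 : 2 * p ∈ S <;>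
    by_cases c4 : 2 * p + 1 ∈ S <;> by_cases c5 : 2 * p' ∈ S <;> by_cases c6 : 2 * p' + 1 ∈ S <;>
    simp only [c1, c2, c3, c4, c5, c6, if_true, if_false, not_true_eq_false, not_false_eq_true,
      or_true, true_or, or_false, false_or, and_true, and_false, forall_const, false_imp_iff]
    at * <;> norm_num <;> tauto

lemma three_level_bound {k q q' : ℕ} {S : Finset ℕ}
    (hS : IsLocDomSetOn (hyperTree (k + 3)) (treeVerts (k + 3)) S)
    (h2 : 2 * 2 ^ k ≤ q) (h3 : q < 3 * 2 ^ k) (hq' : q' = q + 2 ^ k) :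
    6 ≤ ind S q + ind S q' + blockCount S (2 * q) (2 * q') +
      blockCount S (2 * q + 1) (2 * q' + 1) := by
  have hpos := Nat.two_pow_pos k
  have hk : 2 ^ (k + 1) = 2 * 2 ^ k := by rw [pow_succ]; ring
  obtain ⟨-, -, loc⟩ := isLocDomSetOn_iff.1 hS
  have hV : ∀ x, 1 ≤ x → x < 8 * 2 ^ k → x ∈ treeVerts (k + 3) := by
    intro x h h'
    rw [mem_treeVerts, pow_succ, pow_succ, pow_succ, pow_succ]
    omega
  have a1 (w) : (hyperTree (k + 3)).Adj w (2 * q) ↔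
      w = q ∨ w = 2 * q' ∨ w = 2 * (2 * q) ∨ w = 2 * (2 * q) + 1 := by
    rw [adj_nonroot (j := k + 1) (by omega) (by omega) (by omega)]; omega
  have a2 (w) : (hyperTree (k + 3)).Adj w (2 * q + 1) ↔
      w = q ∨ w = 2 * q' + 1 ∨ w = 2 * (2 * q + 1) ∨ w = 2 * (2 * q + 1) + 1 := by
    rw [adj_nonroot (j := k + 1) (by omega) (by omega) (by omega)]; omega
  have a1' (w) : (hyperTree (k + 3)).Adj w (2 * q') ↔
      w = q' ∨ w = 2 * q ∨ w = 2 * (2 * q') ∨ w = 2 * (2 * q') + 1 := by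
    rw [adj_nonroot (j := k + 1) (by omega) (by omega) (by omega)]; omega
  have a2' (w) : (hyperTree (k + 3)).Adj w (2 * q' + 1) ↔
      w = q' ∨ w = 2 * q + 1 ∨ w = 2 * (2 * q' + 1) ∨ w = 2 * (2 * q' + 1) + 1 := by
    rw [adj_nonroot (j := k + 1) (by omega) (by omega) (by omega)]; omega
  have l := loc _ (hV (2 * q) (by omega) (by omega)) _ (hV (2 * q + 1) (by omega) (by omega))
  have l' := loc _ (hV (2 * q') (by omega) (by omega)) _ (hV (2 * q' + 1) (by omega) (by omega))
  simp only [a1, a2, a1', a2'] at l l'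
  obtain ⟨g1, g1'⟩ := two_level_bound (j := k + 1) (p := 2 * q) (p' := 2 * q') hS (by omega)
    (by omega) (by omega)
  obtain ⟨g2, g2'⟩ := two_level_bound (j := k + 1) (p := 2 * q + 1) (p' := 2 * q' + 1) hS
    (by omega) (by omega) (by omega)
  rw [show 2 * q / 2 = q by omega, show 2 * q' / 2 = q' by omega] at g1'
  rw [show (2 * q + 1) / 2 = q by omega, show (2 * q' + 1) / 2 = q' by omega] at g2'
  by_contra hlt
  have hq := ind_le_one S q
  have hq1 := ind_le_one S q'
  have hnot : ¬(q ∈ S ∧ q' ∈ S) := by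
    rintro ⟨h, h'⟩
    rw [ind_mem h, ind_mem h'] at hlt
    omega
  have one : q ∈ S ∨ q' ∈ S → ind S q + ind S q' ≥ 1 := by
    rintro (h | h) <;> rw [ind_mem h] <;> omega
  rcases g1' with g1' | g1' | g1' | g1' <;> rcases g2' with g2' | g2' | g2' | g2'
  all_goals first
    | exact hnot g1'
    | exact hnot g2'
    | exact hnot ⟨g1'.1, g2'.1⟩
    | exact hnot ⟨g2'.1, g1'.1⟩
    | omega
    | (have := one (by tauto); omega)
    | (have := l (by tauto) (by tauto) (by grind); omega)

lemma bottom_bound {k : ℕ} {S : Finset ℕ}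
    (hS : IsLocDomSetOn (hyperTree (k + 3)) (treeVerts (k + 3)) S) :
    ∑ x ∈ Finset.Ico 1 (2 ^ (k + 1)), ind S x + 6 * 2 ^ k ≤ S.card := by
  rw [card_eq_sum_ind hS.1.1, sum_le_levels _ (k + 3), sum_le_levels _ (k + 2),
    sum_le_levels _ (k + 1)]
  have e1 : 2 ^ (k + 1) = 2 * 2 ^ k := by rw [pow_succ]; ring
  have e2 : 2 ^ (k + 1 + 1) = 2 * (2 * 2 ^ k) := by rw [pow_succ, e1]; ring
  have e3 : 2 ^ (k + 2 + 1) = 2 * (2 * (2 * 2 ^ k)) := by rw [pow_succ, e2]; ring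
  have e4 : 2 ^ (k + 3 + 1) = 2 * (2 * (2 * (2 * 2 ^ k))) := by rw [pow_succ, e3]; ring
  have hb : ∑ q ∈ Finset.Ico (2 * 2 ^ k) (3 * 2 ^ k), 6 ≤
      ∑ q ∈ Finset.Ico (2 * 2 ^ k) (3 * 2 ^ k), (ind S q + ind S (q + 2 ^ k) +
        blockCount S (2 * q) (2 * (q + 2 ^ k)) +
        blockCount S (2 * q + 1) (2 * (q + 2 ^ k) + 1)) := by
    refine Finset.sum_le_sum fun q hq => ?_
    rw [Finset.mem_Ico] at hq
    exact three_level_bound hS hq.1 hq.2 rfl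
  rw [Finset.sum_const, Nat.card_Ico, smul_eq_mul, show 3 * 2 ^ k - 2 * 2 ^ k = 2 ^ k by omega]
    at hb
  simp only [e1, e2, e3, e4]
  rw [add_assoc, add_assoc, add_le_add_iff_left, mul_comm]
  refine hb.trans (le_of_eq ?_)
  rw [sum_Ico_double _ (show 2 * (2 * 2 ^ k) ≤ 2 * (2 * (2 * 2 ^ k)) by omega),
    sum_Ico_double _ (show 2 * 2 ^ k ≤ 2 * (2 * 2 ^ k) by omega),
    sum_Ico_double _ (show 2 * 2 ^ k ≤ 2 * (2 * 2 ^ k) by omega),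
    show 2 * (2 * 2 ^ k) = 4 * 2 ^ k by ring, sum_Ico_pair, sum_Ico_pair, sum_Ico_pair,
    ← Finset.sum_add_distrib, ← Finset.sum_add_distrib]
  refine Finset.sum_congr rfl fun q _ => ?_
  simp only [blockCount]
  ring

/-- The restriction of `S` to the first levels, with every vertex of the last of these levels
that has a child in `S` added. -/
def truncation (N : ℕ) (S : Finset ℕ) : Finset ℕ :=
  (treeVerts N).filter fun x => x ∈ S ∨ (2 ^ N ≤ x ∧ (2 * x ∈ S ∨ 2 * x + 1 ∈ S))

lemma truncation_isLocDomSetOn {N n : ℕ} (hn : N ≤ n) {S : Finset ℕ}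
    (hS : IsLocDomSetOn (hyperTree n) (treeVerts n) S) :
    IsLocDomSetOn (hyperTree N) (treeVerts N) (truncation N S) := by
  obtain ⟨-, dom, loc⟩ := isLocDomSetOn_iff.1 hS
  have hsub : ∀ x ∈ treeVerts N, x ∈ treeVerts n := by
    intro x hx
    have hp : 2 ^ (N + 1) ≤ 2 ^ (n + 1) := Nat.pow_le_pow_right (by norm_num) (by omega)
    rw [mem_treeVerts] at hx ⊢
    omega
  have mem : ∀ x ∈ treeVerts N, x ∉ truncation N S →
      x ∉ S ∧ ∀ w ∈ S, (hyperTree n).Adj w x → (hyperTree N).Adj w x ∧ w ∈ truncation N S := by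
    intro x hx hxS
    simp only [truncation, Finset.mem_filter, hx, true_and, not_or, not_and] at hxS
    refine ⟨hxS.1, fun w hw hadj => ?_⟩
    have hwN : w ∈ treeVerts N := by
      have hx1 := (mem_treeVerts.1 hx).1
      have hx2 := (mem_treeVerts.1 hx).2
      have hw1 := (mem_treeVerts.1 (adj_iff.1 hadj).1).1
      rw [mem_treeVerts]
      refine ⟨hw1, ?_⟩
      by_cases hlow : 2 ^ N ≤ x
      · obtain ⟨-, -, -, h | h | h | h | ⟨j, -, h⟩⟩ := adj_iff.1 hadj
        · omega
        · omega
        · exact absurd (h ▸ hw) (hxS.2 hlow).1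
        · exact absurd (h ▸ hw) (hxS.2 hlow).2
        · have hj := level_le hx h.2.2.1
          have : 2 ^ (j + 2) ≤ 2 ^ (N + 1) := Nat.pow_le_pow_right (by norm_num) (by omega)
          rw [pow_add] at this
          omega
      · rw [pow_succ]
        obtain ⟨-, -, -, h | h | h | h | ⟨j, -, h⟩⟩ := adj_iff.1 hadj
        · omega
        · omega
        · omega
        · omega
        · have hj := level_le hx h.2.2.1
          have : 2 ^ (j + 2) ≤ 2 ^ (N + 1) := Nat.pow_le_pow_right (by norm_num) (by omega)
          rw [pow_add, pow_succ] at this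
          omega
    refine ⟨(adj_of_le hn).2 ⟨hadj, hwN, hx⟩, ?_⟩
    simp only [truncation, Finset.mem_filter]
    exact ⟨hwN, .inl hw⟩
  rw [isLocDomSetOn_iff]
  refine ⟨Finset.filter_subset _ _, ?_, ?_⟩
  · intro v hv hvS
    obtain ⟨h1, h2⟩ := mem v hv hvS
    obtain ⟨w, hw, hadj⟩ := dom v (hsub v hv) h1
    exact ⟨w, (h2 w hw hadj).2, (h2 w hw hadj).1⟩
  · intro u hu v hv huS hvS h
    obtain ⟨u1, u2⟩ := mem u hu huS
    obtain ⟨v1, v2⟩ := mem v hv hvS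
    refine loc u (hsub u hu) v (hsub v hv) u1 v1 fun w hw => ⟨fun hadj => ?_, fun hadj => ?_⟩
    · obtain ⟨h3, h4⟩ := u2 w hw hadj
      exact ((adj_of_le hn).1 ((h w h4).1 h3)).1
    · obtain ⟨h3, h4⟩ := v2 w hw hadj
      exact ((adj_of_le hn).1 ((h w h4).2 h3)).1

lemma card_truncation_le (N : ℕ) (S : Finset ℕ) :
    (truncation N S).card ≤ ∑ x ∈ Finset.Ico 1 (2 ^ (N + 2)), ind S x := by
  have e1 : 2 ^ (N + 1) = 2 * 2 ^ N := by rw [pow_succ]; ring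
  have e2 : 2 ^ (N + 2) = 2 * (2 * 2 ^ N) := by rw [pow_add]; ring
  have hlow : ∑ x ∈ Finset.Ico 1 (2 ^ N), ind (truncation N S) x =
      ∑ x ∈ Finset.Ico 1 (2 ^ N), ind S x := by
    refine Finset.sum_congr rfl fun x hx => ?_
    rw [Finset.mem_Ico] at hx
    have : x ∈ truncation N S ↔ x ∈ S := by
      simp only [truncation, Finset.mem_filter, mem_treeVerts]
      refine ⟨fun h => ?_, fun h => ⟨by omega, .inl h⟩⟩
      rcases h.2 with h | h
      · exact h
      · omega
    simp only [ind, this]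
  have hlast : ∑ x ∈ Finset.Ico (2 ^ N) (2 ^ (N + 1)), ind (truncation N S) x ≤
      ∑ x ∈ Finset.Ico (2 ^ N) (2 ^ (N + 1)), (ind S x + (ind S (2 * x) + ind S (2 * x + 1))) := by
    refine Finset.sum_le_sum fun x _ => ?_
    by_cases h : x ∈ truncation N S
    · rw [ind_mem h]
      simp only [truncation, Finset.mem_filter] at h
      rcases h.2 with h | ⟨-, h | h⟩ <;> rw [ind_mem h] <;> omega
    · rw [ind_notMem h]; omega
  rw [card_eq_sum_ind (n := N) (S := truncation N S) (Finset.filter_subset _ _), sum_le_levels, sum_le_levels _ (N + 1),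
    sum_le_levels _ N, hlow, add_assoc]
  refine Nat.add_le_add_left (hlast.trans (le_of_eq ?_)) _
  rw [Finset.sum_add_distrib, e2, e1, sum_Ico_double _ (by omega)]

/-- The locating-domination number of `HT(n)`, by recursion in steps of four levels. -/
def minCard : ℕ → ℕ
  | 0 => 1
  | 1 => 2
  | 2 => 3
  | 3 => 6
  | n + 4 => minCard n + 12 * 2 ^ n

lemma minCard_le : ∀ (n : ℕ) {S : Finset ℕ},
    IsLocDomSetOn (hyperTree n) (treeVerts n) S → minCard n ≤ S.card
  | 0, S, hS => by
    obtain ⟨-, dom, -⟩ := isLocDomSetOn_iff.1 hS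
    refine Finset.card_pos.2 ?_
    by_cases h : 1 ∈ S
    · exact ⟨1, h⟩
    · obtain ⟨w, hw, -⟩ := dom 1 (by simp [mem_treeVerts]) h
      exact ⟨w, hw⟩
  | 1, S, hS => by
    obtain ⟨-, -, loc⟩ := isLocDomSetOn_iff.1 hS
    have a1 (w) : (hyperTree 1).Adj w 1 ↔ w = 2 ∨ w = 3 := by rw [adj_one]; omega
    have a2 (w) : (hyperTree 1).Adj w 2 ↔ w = 1 ∨ w = 3 := by
      rw [adj_nonroot (j := 0) (by omega) (by omega) (by omega)]; omega
    have a3 (w) : (hyperTree 1).Adj w 3 ↔ w = 1 ∨ w = 2 := by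
      rw [adj_nonroot (j := 0) (by omega) (by omega) (by omega)]; omega
    have l1 := loc 1 (by simp [mem_treeVerts]) 2 (by simp [mem_treeVerts])
    have l2 := loc 1 (by simp [mem_treeVerts]) 3 (by simp [mem_treeVerts])
    have l3 := loc 2 (by simp [mem_treeVerts]) 3 (by simp [mem_treeVerts])
    simp only [a1, a2, a3] at l1 l2 l3
    have h12 : 1 ∈ S ∨ 2 ∈ S := by grind
    have h13 : 1 ∈ S ∨ 3 ∈ S := by grind
    have h23 : 2 ∈ S ∨ 3 ∈ S := by grind
    rw [card_eq_sum_ind hS.1.1]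
    simp only [ind_eq_one] at h12 h13 h23
    simp only [minCard, show Finset.Ico 1 (2 ^ (1 + 1)) = {1, 2, 3} by decide]
    simp
    omega
  | 2, S, hS => by
    obtain ⟨h1, h2⟩ := two_level_bound (j := 0) (p := 2) (p' := 3) hS (by norm_num) (by norm_num)
      (by norm_num)
    have key : 3 ≤ ind S 1 + blockCount S 2 3 := by
      norm_num at h2
      rcases h2 with h | h | h | h
      · omega
      · rw [ind_mem h]; omega
      · rw [ind_mem h.1]; omega
      · rw [ind_mem h.1]; omega
    rw [card_eq_sum_ind hS.1.1]
    simp only [minCard, show Finset.Ico 1 (2 ^ (2 + 1)) = {1, 2, 3, 4, 5, 6, 7} by decide]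
    simp [blockCount] at key ⊢
    omega
  | 3, S, hS => by
    have h := bottom_bound (k := 0) hS
    simp only [minCard]
    omega
  | n + 4, S, hS => by
    have h1 : ∑ x ∈ Finset.Ico 1 (2 ^ (n + 2)), ind S x + 6 * 2 ^ (n + 1) ≤ S.card :=
      bottom_bound (k := n + 1) hS
    have h2 := minCard_le n (truncation_isLocDomSetOn (by omega) hS)
    have h3 := card_truncation_le n S
    simp only [minCard]
    rw [pow_succ 2 n] at h1
    omega

/-- A minimum locating-dominating set of `HT(n)`: counting levels from the last one, it contains
one vertex of each adjacent pair in the levels `0, 4, 8, …` and all of the levels `2, 6, 10, …`. -/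
def optimalSet (n : ℕ) : Finset ℕ :=
  (treeVerts n).filter fun x => (n - Nat.log 2 x) % 4 = 2 ∨ ((n - Nat.log 2 x) % 4 = 0 ∧
    ((x % 2 = 0 ∧ 2 * x < 3 * 2 ^ Nat.log 2 x) ∨ (x % 2 = 1 ∧ 3 * 2 ^ Nat.log 2 x ≤ 2 * x + 1)))

lemma mem_optimalSet {n i x : ℕ} (hi : i ≤ n) (h1 : 2 ^ i ≤ x) (h2 : x < 2 ^ (i + 1)) :
    x ∈ optimalSet n ↔ (n - i) % 4 = 2 ∨ ((n - i) % 4 = 0 ∧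
      ((x % 2 = 0 ∧ 2 * x < 3 * 2 ^ i) ∨ (x % 2 = 1 ∧ 3 * 2 ^ i ≤ 2 * x + 1))) := by
  have hx : x ∈ treeVerts n := by
    have hp : 2 ^ (i + 1) ≤ 2 ^ (n + 1) := Nat.pow_le_pow_right (by norm_num) (by omega)
    have := Nat.two_pow_pos i
    rw [mem_treeVerts]
    omega
  rw [optimalSet, Finset.mem_filter, Nat.log_eq_of_pow_le_of_lt_pow h1 h2]
  simp only [hx, true_and]

lemma mem_optimalSet_succ {n j x : ℕ} (hj : j + 1 ≤ n) (h1 : 2 * 2 ^ j ≤ x) (h2 : x < 4 * 2 ^ j) :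
    x ∈ optimalSet n ↔ (n - (j + 1)) % 4 = 2 ∨ ((n - (j + 1)) % 4 = 0 ∧
      ((x % 2 = 0 ∧ x < 3 * 2 ^ j) ∨ (x % 2 = 1 ∧ 3 * 2 ^ j ≤ x))) := by
  rw [mem_optimalSet hj (by rw [pow_succ]; omega) (by rw [pow_succ, pow_succ]; omega), pow_succ]
  omega

/-- The possible neighbourhoods in `optimalSet n` of a vertex outside it. -/
lemma optimalSet_nbrs {n u : ℕ} (hu : u ∈ treeVerts n) (huS : u ∉ optimalSet n) :
    (2 * u ∈ optimalSet n ∧ 2 * u + 1 ∈ optimalSet n ∧ (hyperTree n).Adj (2 * u) u ∧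
      (hyperTree n).Adj (2 * u + 1) u) ∨
    (2 ≤ u ∧ u / 2 ∈ optimalSet n ∧ (hyperTree n).Adj (u / 2) u ∧
      ∃ c ∈ optimalSet n, c / 2 = u ∧ (hyperTree n).Adj c u) ∨
    ∃ j c, 2 * 2 ^ j ≤ u ∧ u < 4 * 2 ^ j ∧ c ∈ optimalSet n ∧ (hyperTree n).Adj c u ∧
      ((u < 3 * 2 ^ j ∧ c = u + 2 ^ j) ∨ (3 * 2 ^ j ≤ u ∧ c + 2 ^ j = u)) ∧
      ∀ w ∈ optimalSet n, (hyperTree n).Adj w u → w = c := by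
  rcases (show u = 1 ∨ 2 ≤ u by have := (mem_treeVerts.1 hu).1; omega) with rfl | hu2
  · rw [mem_optimalSet (i := 0) (by omega) (by norm_num) (by norm_num)] at huS
    left
    have hn : 1 ≤ n := by
      by_contra h
      obtain rfl : n = 0 := by omega
      simp at huS
    rw [adj_one, adj_one, mem_optimalSet_succ (j := 0) hn (by norm_num) (by norm_num),
      mem_optimalSet_succ (j := 0) hn (by norm_num) (by norm_num)]
    norm_num at huS ⊢
    omega
  · obtain ⟨j, h2, h4⟩ := exists_level hu2
    have hj := level_le hu h2
    have hadj (w) := adj_nonroot (w := w) hj h2 h4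
    have hmem := mem_optimalSet_succ hj h2 h4
    have hpos := Nat.two_pow_pos j
    have hps : 2 ^ (j + 1) = 2 * 2 ^ j := by rw [pow_succ]; ring
    have hpar : u / 2 ∈ optimalSet n ↔ (n - j) % 4 = 2 ∨ ((n - j) % 4 = 0 ∧
      ((u / 2 % 2 = 0 ∧ 2 * (u / 2) < 3 * 2 ^ j) ∨
        (u / 2 % 2 = 1 ∧ 3 * 2 ^ j ≤ 2 * (u / 2) + 1))) :=
      mem_optimalSet (by omega) (by omega) (by omega)
    have hchild : ∀ c, c = 2 * u ∨ c = 2 * u + 1 → j + 1 < n → (c ∈ optimalSet n ↔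
        (n - (j + 2)) % 4 = 2 ∨ ((n - (j + 2)) % 4 = 0 ∧
      ((c % 2 = 0 ∧ c < 6 * 2 ^ j) ∨ (c % 2 = 1 ∧ 6 * 2 ^ j ≤ c)))) := by
      intro c hc hlt
      rw [mem_optimalSet_succ (j := j + 1) (by omega) (by omega) (by omega), hps]
      omega
    have hparity : 2 ^ j = 1 ∨ 2 ^ j % 2 = 0 := by
      cases j with
      | zero => exact .inl rfl
      | succ j => rw [pow_succ]; omega
    rw [hmem] at huS
    rcases (show (n - (j + 1)) % 4 = 0 ∨ (n - (j + 1)) % 4 = 1 ∨ (n - (j + 1)) % 4 = 3 by omega)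
      with hd | hd | hd
    · right; right
      rcases Nat.lt_or_ge u (3 * 2 ^ j) with hlow | hhigh
      · refine ⟨j, u + 2 ^ j, h2, h4, ?_, ?_, by omega, ?_⟩
        · rw [mem_optimalSet_succ hj (by omega) (by omega)]
          omega
        · rw [hadj]; omega
        · intro w hw hwu
          rw [hadj] at hwu
          rcases hwu with rfl | h | h | ⟨hlt, h⟩
          · rw [hpar] at hw; omega
          · omega
          · omega
          · rw [hchild w h hlt] at hw; omega
      · obtain ⟨c, rfl⟩ : ∃ c, u = c + 2 ^ j := ⟨u - 2 ^ j, by omega⟩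
        refine ⟨j, c, h2, h4, ?_, ?_, by omega, ?_⟩
        · rw [mem_optimalSet_succ hj (by omega) (by omega)]
          omega
        · rw [hadj]; omega
        · intro w hw hwu
          rw [hadj] at hwu
          rcases hwu with rfl | h | h | ⟨hlt, h⟩
          · rw [hpar] at hw; omega
          · omega
          · omega
          · rw [hchild w h hlt] at hw; omega
    · right; left
      have hc0 := hchild (2 * u) (.inl rfl) (by omega)
      have hc1 := hchild (2 * u + 1) (.inr rfl) (by omega)
      refine ⟨hu2, by rw [hpar]; omega, by rw [hadj]; omega, ?_⟩
      rcases Nat.lt_or_ge u (3 * 2 ^ j) with hlow | hhigh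
      · exact ⟨2 * u, by rw [hc0]; omega, by omega, by rw [hadj]; omega⟩
      · exact ⟨2 * u + 1, by rw [hc1]; omega, by omega, by rw [hadj]; omega⟩
    · left
      have hc0 := hchild (2 * u) (.inl rfl) (by omega)
      have hc1 := hchild (2 * u + 1) (.inr rfl) (by omega)
      rw [hc0, hc1, hadj, hadj]
      omega

/-- A vertex is the only common neighbour of its two children. -/
lemma eq_of_adj_children {n u v : ℕ} (hu : 1 ≤ u) (h1 : (hyperTree n).Adj (2 * u) v)
    (h2 : (hyperTree n).Adj (2 * u + 1) v) : v = u := by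
  have hv := (adj_iff.1 h1).2.1
  rcases (show v = 1 ∨ 2 ≤ v by have := (mem_treeVerts.1 hv).1; omega) with rfl | hv2
  · rw [adj_one] at h1 h2
    omega
  · obtain ⟨j, hj2, hj4⟩ := exists_level hv2
    have hj := level_le hv hj2
    have hpos := Nat.two_pow_pos j
    rw [adj_nonroot hj hj2 hj4] at h1 h2
    omega

/-- A vertex is the only common neighbour of its parent and any of its children. -/
lemma eq_of_adj_parent_child {n u v c : ℕ} (hu : 2 ≤ u) (hc : c / 2 = u)
    (h1 : (hyperTree n).Adj (u / 2) v) (h2 : (hyperTree n).Adj c v) : v = u := by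
  have hv := (adj_iff.1 h1).2.1
  rcases (show v = 1 ∨ 2 ≤ v by have := (mem_treeVerts.1 hv).1; omega) with rfl | hv2
  · rw [adj_one] at h1 h2
    omega
  · obtain ⟨j, hj2, hj4⟩ := exists_level hv2
    have hj := level_le hv hj2
    have hpos := Nat.two_pow_pos j
    rw [adj_nonroot hj hj2 hj4] at h1 h2
    omega

lemma optimalSet_isLocDomSetOn (n : ℕ) :
    IsLocDomSetOn (hyperTree n) (treeVerts n) (optimalSet n) := by
  rw [isLocDomSetOn_iff]
  refine ⟨Finset.filter_subset _ _, ?_, ?_⟩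
  · intro v hv hvS
    rcases optimalSet_nbrs hv hvS with ⟨h, -, h', -⟩ | ⟨-, h, h', -⟩ | ⟨j, c, -, -, h, h', -⟩
    exacts [⟨_, h, h'⟩, ⟨_, h, h'⟩, ⟨_, h, h'⟩]
  · intro u hu v hv huS hvS huv
    have hu1 := (mem_treeVerts.1 hu).1
    have hv1 := (mem_treeVerts.1 hv).1
    rcases optimalSet_nbrs hu huS with ⟨ha, hb, ha', hb'⟩ | ⟨h2, ha, ha', c, hc, hcu, hc'⟩ |
      ⟨j, c, hj2, hj4, hc, hc', hcu, -⟩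
    · exact (eq_of_adj_children hu1 ((huv _ ha).1 ha') ((huv _ hb).1 hb')).symm
    · exact (eq_of_adj_parent_child h2 hcu ((huv _ ha).1 ha') ((huv _ hc).1 hc')).symm
    · rcases optimalSet_nbrs hv hvS with ⟨ha, hb, ha', hb'⟩ | ⟨h2, ha, ha', d, hd, hdv, hd'⟩ |
        ⟨i, d, hi2, hi4, hd, hd', hdv, huniq⟩
      · exact eq_of_adj_children hv1 ((huv _ ha).2 ha') ((huv _ hb).2 hb')
      · exact eq_of_adj_parent_child h2 hdv ((huv _ ha).2 ha') ((huv _ hd).2 hd')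
      · obtain rfl := huniq c hc ((huv c hc).1 hc')
        have : i + 1 = j + 1 := level_unique (x := c) (by rw [pow_succ]; omega)
          (by rw [pow_succ, pow_succ]; omega) (by rw [pow_succ]; omega)
          (by rw [pow_succ, pow_succ]; omega)
        obtain rfl : i = j := by omega
        omega

lemma card_optimalSet_le : ∀ n : ℕ, (optimalSet n).card ≤ minCard n
  | 0 => by decide
  | 1 => by decide
  | 2 => by decide
  | 3 => by decide
  | n + 4 => by
    have ih := card_optimalSet_le n
    have hpos := Nat.two_pow_pos n
    have e1 : 2 ^ (n + 1) = 2 * 2 ^ n := by rw [pow_succ]; ring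
    have e2 : 2 ^ (n + 2) = 4 * 2 ^ n := by rw [pow_add]; ring
    have e3 : 2 ^ (n + 3) = 8 * 2 ^ n := by rw [pow_add]; ring
    have e4 : 2 ^ (n + 4) = 16 * 2 ^ n := by rw [pow_add]; ring
    have e5 : 2 ^ (n + 5) = 32 * 2 ^ n := by rw [pow_add]; ring
    have s0 : ∑ x ∈ Finset.Ico 1 (2 ^ (n + 1)), ind (optimalSet (n + 4)) x =
        (optimalSet n).card := by
      rw [card_eq_sum_ind (n := n) (S := optimalSet n) (Finset.filter_subset _ _)]
      refine Finset.sum_congr rfl fun x hx => ?_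
      rw [Finset.mem_Ico] at hx
      have hlog : Nat.log 2 x < n + 1 := Nat.log_lt_of_lt_pow (by omega) hx.2
      have h1 := Nat.pow_log_le_self 2 (show x ≠ 0 by omega)
      have h2 := Nat.lt_pow_succ_log_self (b := 2) (by norm_num) x
      simp only [ind, mem_optimalSet (n := n) (by omega) h1 h2,
        mem_optimalSet (n := n + 4) (by omega) h1 h2,
        show (n + 4 - Nat.log 2 x) % 4 = (n - Nat.log 2 x) % 4 by omega]
    have s1 : ∑ x ∈ Finset.Ico (2 ^ (n + 1)) (2 ^ (n + 2)), ind (optimalSet (n + 4)) x = 0 := by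
      refine Finset.sum_eq_zero fun x hx => ind_notMem ?_
      rw [Finset.mem_Ico] at hx
      rw [mem_optimalSet (i := n + 1) (by omega) hx.1 hx.2]
      omega
    have s2 : ∑ x ∈ Finset.Ico (2 ^ (n + 2)) (2 ^ (n + 3)), ind (optimalSet (n + 4)) x ≤
        4 * 2 ^ n := by
      refine (Finset.sum_le_sum fun x _ => ind_le_one _ x).trans ?_
      rw [Finset.sum_const, Nat.card_Ico, smul_eq_mul]
      omega
    have s3 : ∑ x ∈ Finset.Ico (2 ^ (n + 3)) (2 ^ (n + 4)), ind (optimalSet (n + 4)) x = 0 := by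
      refine Finset.sum_eq_zero fun x hx => ind_notMem ?_
      rw [Finset.mem_Ico] at hx
      rw [mem_optimalSet (i := n + 3) (by omega) hx.1 hx.2]
      omega
    have s4 : ∑ x ∈ Finset.Ico (2 ^ (n + 4)) (2 ^ (n + 5)), ind (optimalSet (n + 4)) x ≤
        8 * 2 ^ n := by
      rw [show 2 ^ (n + 4) = 2 * 2 ^ (n + 3) by omega, show 2 ^ (n + 5) = 2 * 2 ^ (n + 4) by omega,
        sum_Ico_double _ (by omega)]
      have h : ∀ p ∈ Finset.Ico (2 ^ (n + 3)) (2 ^ (n + 4)),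
          ind (optimalSet (n + 4)) (2 * p) + ind (optimalSet (n + 4)) (2 * p + 1) ≤ 1 := by
        intro p hp
        rw [Finset.mem_Ico] at hp
        have m0 := mem_optimalSet (n := n + 4) (i := n + 4) (x := 2 * p) (by omega) (by omega)
          (by rw [e5]; omega)
        have m1 := mem_optimalSet (n := n + 4) (i := n + 4) (x := 2 * p + 1) (by omega) (by omega)
          (by rw [e5]; omega)
        by_contra hlt
        have h0 : 2 * p ∈ optimalSet (n + 4) := by
          by_contra h0
          have := ind_le_one (optimalSet (n + 4)) (2 * p + 1)
          rw [ind_notMem h0] at hlt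
          omega
        have h1 : 2 * p + 1 ∈ optimalSet (n + 4) := by
          by_contra h1
          have := ind_le_one (optimalSet (n + 4)) (2 * p)
          rw [ind_notMem h1] at hlt
          omega
        rw [m0] at h0
        rw [m1] at h1
        omega
      refine (Finset.sum_le_sum h).trans ?_
      rw [Finset.sum_const, Nat.card_Ico, smul_eq_mul]
      omega
    rw [card_eq_sum_ind (n := n + 4) (S := optimalSet (n + 4)) (Finset.filter_subset _ _),
      sum_le_levels _ (n + 4), sum_le_levels _ (n + 3), sum_le_levels _ (n + 2),
      sum_le_levels _ (n + 1), minCard]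
    simp only [Nat.add_assoc, Nat.reduceAdd]
    omega

lemma locDomNum_eq_minCard (n : ℕ) : locDomNum (hyperTree n) (treeVerts n) = minCard n := by
  have hmem : minCard n ∈ {k | ∃ S : Finset ℕ,
      IsLocDomSetOn (hyperTree n) (treeVerts n) S ∧ S.card = k} :=
    ⟨optimalSet n, optimalSet_isLocDomSetOn n,
      (card_optimalSet_le n).antisymm (minCard_le n (optimalSet_isLocDomSetOn n))⟩
  refine le_antisymm (Nat.sInf_le hmem) (le_csInf ⟨_, hmem⟩ ?_)
  rintro k ⟨S, hS, rfl⟩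
  exact minCard_le n hS

lemma minCard_formula : ∀ n : ℕ,
    (n % 4 = 0 → 5 * minCard n = 2 ^ (n + 2) + 1) ∧ (n % 4 = 1 → 5 * minCard n = 2 ^ (n + 2) + 2) ∧
    (n % 4 = 2 → 5 * minCard n + 1 = 2 ^ (n + 2)) ∧ (n % 4 = 3 → 5 * minCard n + 2 = 2 ^ (n + 2))
  | 0 => by decide
  | 1 => by decide
  | 2 => by decide
  | 3 => by decide
  | n + 4 => by
    have ih := minCard_formula n
    rw [pow_add] at ih
    simp only [minCard, Nat.add_mod_right]
    rw [show n + 4 + 2 = n + 6 by rfl, pow_add]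
    omega

end HyperTree

/-- The locating-domination number of the hypertree `HT(n)`, `n ≥ 1`. -/
theorem locDomNum_hyperTree (n : ℕ) (hn : 1 ≤ n) :
    (n % 4 = 0 → locDomNum (hyperTree n) (treeVerts n) = (2 ^ (n + 2) + 1) / 5) ∧
    (n % 4 = 1 → locDomNum (hyperTree n) (treeVerts n) = (2 ^ (n + 2) + 2) / 5) ∧
    (n % 4 = 2 → locDomNum (hyperTree n) (treeVerts n) = (2 ^ (n + 2) - 1) / 5) ∧
    (n % 4 = 3 → locDomNum (hyperTree n) (treeVerts n) = (2 ^ (n + 2) - 2) / 5) := by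
  rw [HyperTree.locDomNum_eq_minCard]
  have := HyperTree.minCard_formula n
  omega
end

section
/- Let G be the hypertree HT(n) with n ≥ 2, and let S be a locating-total dominating set of G of minimum cardinality (i.e. |S| = γ^L_t(G)). Then S contains at least 3·2^{n-2} vertices whose labels lie in levels n-1 and n, i.e. |S ∩ {x : 2^{n-1} ≤ x ≤ 2^{n+1}-1}| ≥ 3·2^{n-2}. -/
/-- The neighbours of a leaf `v` of `HT(n)`, `n = j + 2`: its parent and its horizontal partner. -/
theorem hyperTree_adj_leaf (j v w : ℕ) (hv : 4 * 2 ^ j ≤ v) (hv' : v < 8 * 2 ^ j) :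
    (hyperTree (j + 2)).Adj w v ↔
      w = v / 2 ∨ (w = v + 2 * 2 ^ j ∧ v < 6 * 2 ^ j) ∨ (v = w + 2 * 2 ^ j ∧ 6 * 2 ^ j ≤ v) := by
  have hp : 0 < 2 ^ j := by positivity
  have h1 : 2 ^ (j + 1) = 2 * 2 ^ j := by ring
  have h2 : 2 ^ (j + 2) = 4 * 2 ^ j := by ring
  have h3 : 2 ^ (j + 2 + 1) = 8 * 2 ^ j := by ring
  have level : ∀ i, i ≤ j + 2 → v < 2 ^ (i + 1) → i = j + 2 := by
    intro i hi h
    by_contra hne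
    have := Nat.pow_le_pow_right (n := 2) (by norm_num) (show i + 1 ≤ j + 2 by omega)
    omega
  simp only [hyperTree, SimpleGraph.fromRel_adj, treeVerts, Finset.mem_Icc, h3]
  constructor
  · rintro ⟨-, ⟨_, _, h | h | ⟨i, _, hi, _, _, _, h, h'⟩⟩ |
      ⟨_, _, h | h | ⟨i, _, hi, _, h, _, _, h'⟩⟩⟩
    · omega
    · omega
    · obtain rfl := level i hi h
      rw [show j + 2 - 1 = j + 1 from rfl] at h'
      omega
    · omega
    · omega
    · obtain rfl := level i hi h
      rw [show j + 2 - 1 = j + 1 from rfl] at h'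
      omega
  · rintro (h | ⟨h, _⟩ | ⟨h, _⟩)
    · exact ⟨by omega, Or.inl ⟨by omega, by omega, by omega⟩⟩
    · refine ⟨by omega, Or.inr ⟨by omega, by omega, Or.inr (Or.inr ⟨j + 2, ?_⟩)⟩⟩
      rw [show j + 2 - 1 = j + 1 from rfl]
      omega
    · refine ⟨by omega, Or.inl ⟨by omega, by omega, Or.inr (Or.inr ⟨j + 2, ?_⟩)⟩⟩
      rw [show j + 2 - 1 = j + 1 from rfl]
      omega

/-- Index of the six-vertex block (two partners at level `n - 1` and their children, `n = j + 2`)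
containing a vertex of the last two levels of `HT(n)`. -/
def blockIndex (j v : ℕ) : ℕ :=
  (if v < 4 * 2 ^ j then v else v / 2) % 2 ^ j

theorem blockIndex_upper {j k c : ℕ} (hk : k < 2 ^ j) (hc : c = 2 ∨ c = 3) :
    blockIndex j (c * 2 ^ j + k) = k := by
  rw [blockIndex, if_pos (by rcases hc with rfl | rfl <;> omega), Nat.mul_add_mod_of_lt hk]

theorem blockIndex_lower {j k c e : ℕ} (hk : k < 2 ^ j) (hc : c = 2 ∨ c = 3) (he : e < 2) :
    blockIndex j (2 * (c * 2 ^ j + k) + e) = k := by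
  rw [blockIndex, if_neg (by rcases hc with rfl | rfl <;> omega),
    show (2 * (c * 2 ^ j + k) + e) / 2 = c * 2 ^ j + k by omega, Nat.mul_add_mod_of_lt hk]

theorem three_le_card_block_of_mem {j k : ℕ} {S : Finset ℕ} {u v w : ℕ}
    (hu : u ∈ S) (hv : v ∈ S) (hw : w ∈ S) (iu : blockIndex j u = k) (iv : blockIndex j v = k)
    (iw : blockIndex j w = k) (hlo : 2 * 2 ^ j ≤ u) (huv : u < v) (hvw : v < w)
    (hhi : w < 8 * 2 ^ j) :
    3 ≤ ((S ∩ Finset.Icc (2 * 2 ^ j) (8 * 2 ^ j - 1)).filter (blockIndex j · = k)).card := by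
  refine Finset.two_lt_card.2 ⟨u, ?_, v, ?_, w, ?_, by omega, by omega, by omega⟩ <;>
  · simp only [Finset.mem_filter, Finset.mem_inter, Finset.mem_Icc]
    exact ⟨⟨by assumption, by omega⟩, by assumption⟩

/-- A child of `x`, in the left half of the last level, is adjacent exactly to `x` and to the
corresponding child of the partner of `x`. -/
theorem hyperTree_adj_left_leaf {j k e : ℕ} (hk : k < 2 ^ j) (he : e < 2) (w : ℕ) :
    (hyperTree (j + 2)).Adj w (2 * (2 * 2 ^ j + k) + e) ↔
      w = 2 * 2 ^ j + k ∨ w = 2 * (3 * 2 ^ j + k) + e := by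
  rw [hyperTree_adj_leaf j _ w (by omega) (by omega)]
  omega

/-- The analogue of `hyperTree_adj_left_leaf` for the right half of the last level. -/
theorem hyperTree_adj_right_leaf {j k e : ℕ} (hk : k < 2 ^ j) (he : e < 2) (w : ℕ) :
    (hyperTree (j + 2)).Adj w (2 * (3 * 2 ^ j + k) + e) ↔
      w = 3 * 2 ^ j + k ∨ w = 2 * (2 * 2 ^ j + k) + e := by
  rw [hyperTree_adj_leaf j _ w (by omega) (by omega)]
  omega

/-- Each block contains at least three vertices of a locating-total dominating set. -/
theorem three_le_card_block {j : ℕ} {S : Finset ℕ}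
    (hS : IsLocTotalDomSetOn (hyperTree (j + 2)) (treeVerts (j + 2)) S) {k : ℕ} (hk : k < 2 ^ j) :
    3 ≤ ((S ∩ Finset.Icc (2 * 2 ^ j) (8 * 2 ^ j - 1)).filter (blockIndex j · = k)).card := by
  obtain ⟨⟨-, hdom⟩, hloc⟩ := hS
  have left_mem : ∀ e < 2, 2 * (2 * 2 ^ j + k) + e ∈ treeVerts (j + 2) := by
    intro e he
    rw [treeVerts, Finset.mem_Icc, show 2 ^ (j + 2 + 1) = 8 * 2 ^ j by ring]
    omega
  have right_mem : ∀ e < 2, 2 * (3 * 2 ^ j + k) + e ∈ treeVerts (j + 2) := by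
    intro e he
    rw [treeVerts, Finset.mem_Icc, show 2 ^ (j + 2 + 1) = 8 * 2 ^ j by ring]
    omega
  have left_dom : ∀ e < 2, 2 * 2 ^ j + k ∈ S ∨ 2 * (3 * 2 ^ j + k) + e ∈ S := by
    intro e he
    obtain ⟨u, hu, hadj⟩ := hdom _ (left_mem e he)
    rcases (hyperTree_adj_left_leaf hk he u).1 hadj with rfl | rfl
    · exact Or.inl hu
    · exact Or.inr hu
  have right_dom : ∀ e < 2, 3 * 2 ^ j + k ∈ S ∨ 2 * (2 * 2 ^ j + k) + e ∈ S := by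
    intro e he
    obtain ⟨u, hu, hadj⟩ := hdom _ (right_mem e he)
    rcases (hyperTree_adj_right_leaf hk he u).1 hadj with rfl | rfl
    · exact Or.inl hu
    · exact Or.inr hu
  have ha : blockIndex j (2 * 2 ^ j + k) = k := blockIndex_upper hk (Or.inl rfl)
  have hb : blockIndex j (3 * 2 ^ j + k) = k := blockIndex_upper hk (Or.inr rfl)
  have hac : ∀ e < 2, blockIndex j (2 * (2 * 2 ^ j + k) + e) = k :=
    fun e he => blockIndex_lower hk (Or.inl rfl) he
  have hbc : ∀ e < 2, blockIndex j (2 * (3 * 2 ^ j + k) + e) = k :=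
    fun e he => blockIndex_lower hk (Or.inr rfl) he
  by_cases sa : 2 * 2 ^ j + k ∈ S
  · by_cases sb : 3 * 2 ^ j + k ∈ S
    · by_cases s : ∃ v ∈ S, blockIndex j v = k ∧ 4 * 2 ^ j ≤ v ∧ v < 8 * 2 ^ j
      · obtain ⟨v, hv, iv, h4, h8⟩ := s
        exact three_le_card_block_of_mem sa sb hv ha hb iv
          (by omega) (by omega) (by omega) h8
      · have left_notMem : ∀ e < 2, 2 * (2 * 2 ^ j + k) + e ∉ S :=
          fun e he h => s ⟨_, h, hac e he, by omega, by omega⟩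
        have left_iff : ∀ e < 2, ∀ w ∈ S,
            ((hyperTree (j + 2)).Adj w (2 * (2 * 2 ^ j + k) + e) ↔ w = 2 * 2 ^ j + k) := by
          intro e he w hw
          rw [hyperTree_adj_left_leaf hk he, or_iff_left]
          rintro rfl
          exact s ⟨_, hw, hbc e he, by omega, by omega⟩
        refine absurd ?_ (hloc _ (left_mem 0 two_pos) _ (left_mem 1 one_lt_two)
          (left_notMem 0 two_pos) (left_notMem 1 one_lt_two) (by omega))
        ext w
        exact and_congr_right fun hw =>
          (left_iff 0 two_pos w hw).trans (left_iff 1 one_lt_two w hw).symm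
    · exact three_le_card_block_of_mem sa ((right_dom 0 two_pos).resolve_left sb)
        ((right_dom 1 one_lt_two).resolve_left sb) ha (hac 0 two_pos) (hac 1 one_lt_two)
        le_self_add (by omega) (by omega) (by omega)
  · by_cases sb : 3 * 2 ^ j + k ∈ S
    · exact three_le_card_block_of_mem sb ((left_dom 0 two_pos).resolve_left sa)
        ((left_dom 1 one_lt_two).resolve_left sa) hb (hbc 0 two_pos) (hbc 1 one_lt_two)
        (by omega) (by omega) (by omega) (by omega)
    · exact three_le_card_block_of_mem ((right_dom 0 two_pos).resolve_left sb)
        ((right_dom 1 one_lt_two).resolve_left sb) ((left_dom 0 two_pos).resolve_left sa)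
        (hac 0 two_pos) (hac 1 one_lt_two) (hbc 0 two_pos)
        (by omega) (by omega) (by omega) (by omega)

/-- Any minimum locating-total dominating set of the hypertree `HT(n)`, `n ≥ 2`,
contains at least `3 * 2^(n-2)` vertices from levels `n-1` and `n`. -/
theorem minLocTotalDomSet_hyperTree_lastTwoLevels (n : ℕ) (hn : 2 ≤ n) (S : Finset ℕ)
    (hS : IsLocTotalDomSetOn (hyperTree n) (treeVerts n) S)
    (hmin : S.card = locTotalDomNum (hyperTree n) (treeVerts n)) :
    3 * 2 ^ (n - 2) ≤ (S ∩ Finset.Icc (2 ^ (n - 1)) (2 ^ (n + 1) - 1)).card := by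
  obtain ⟨j, rfl⟩ : ∃ j, n = j + 2 := ⟨n - 2, by omega⟩
  rw [show j + 2 - 2 = j from rfl, show 2 ^ (j + 2 - 1) = 2 * 2 ^ j from pow_succ' 2 j,
    show 2 ^ (j + 2 + 1) = 8 * 2 ^ j by ring]
  have hmaps : Set.MapsTo (blockIndex j)
      (S ∩ Finset.Icc (2 * 2 ^ j) (8 * 2 ^ j - 1) : Finset ℕ) (Finset.range (2 ^ j)) :=
    fun v _ => Finset.mem_coe.2 (Finset.mem_range.2 (Nat.mod_lt _ (by positivity)))
  rw [Finset.card_eq_sum_card_fiberwise hmaps]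
  calc
    3 * 2 ^ j = ∑ _k ∈ Finset.range (2 ^ j), 3 := by simp [mul_comm]
    _ ≤ _ := Finset.sum_le_sum fun k hk => three_le_card_block hS (Finset.mem_range.1 hk)
end

section
/- Let G be the sibling tree ST_n with n ≥ 1, and let S be a dominating set of G of minimum cardinality (i.e. |S| = γ(G)). Then S contains at least 2^{n-1} vertices whose labels lie in levels n-1 and n, i.e. |S ∩ {x : 2^{n-1} ≤ x ≤ 2^{n+1}-1}| ≥ 2^{n-1}. -/
/-- If `x` and `2x` are vertices of the sibling tree and `x` has no grandchildren, then a
dominating set meets the triangle `{x, 2x, 2x+1}`. -/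
theorem IsDomSetOn.exists_mem_triangle {n x : ℕ} {S : Finset ℕ}
    (hS : IsDomSetOn (siblingTree n) (treeVerts n) S) (hx : 1 ≤ x)
    (hx₂ : 2 * x ≤ 2 ^ (n + 1) - 1) (hx₄ : 2 ^ (n + 1) - 1 < 4 * x) :
    ∃ u ∈ S, u = x ∨ u = 2 * x ∨ u = 2 * x + 1 := by
  by_cases h : 2 * x ∈ S
  · exact ⟨2 * x, h, Or.inr (Or.inl rfl)⟩
  obtain ⟨u, hu, hadj⟩ := hS.2 (2 * x) (by simp only [treeVerts, Finset.mem_Icc]; omega) h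
  refine ⟨u, hu, ?_⟩
  simp only [siblingTree, SimpleGraph.fromRel_adj, treeVerts, Finset.mem_Icc] at hadj
  obtain ⟨-, ⟨-, -, h | h | ⟨p, h, h'⟩⟩ | ⟨-, hu', h | h | ⟨p, h, h'⟩⟩⟩ := hadj <;> omega

/-- Any minimum dominating set of the sibling tree `ST_n`, `n ≥ 1`, contains at least
`2^(n-1)` vertices from levels `n-1` and `n`. -/
theorem minDomSet_siblingTree_lastTwoLevels (n : ℕ) (hn : 1 ≤ n) (S : Finset ℕ)
    (hS : IsDomSetOn (siblingTree n) (treeVerts n) S)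
    (hmin : S.card = domNum (siblingTree n) (treeVerts n)) :
    2 ^ (n - 1) ≤ (S ∩ Finset.Icc (2 ^ (n - 1)) (2 ^ (n + 1) - 1)).card := by
  obtain ⟨m, rfl⟩ : ∃ m, n = m + 1 := ⟨n - 1, by omega⟩
  simp only [Nat.add_sub_cancel]
  have h₁ : 2 ^ (m + 1 + 1) = 4 * 2 ^ m := by ring
  have hpos : 1 ≤ 2 ^ m := Nat.one_le_two_pow
  have hsub : Finset.Ico (2 ^ m) (2 * 2 ^ m) ⊆
      (S ∩ Finset.Icc (2 ^ m) (2 ^ (m + 1 + 1) - 1)).image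
        (fun y => if y < 2 * 2 ^ m then y else y / 2) := by
    intro x hx
    rw [Finset.mem_Ico] at hx
    obtain ⟨u, hu, hux⟩ :=
      hS.exists_mem_triangle (x := x) (by omega) (by omega) (by omega)
    refine Finset.mem_image.2 ⟨u, Finset.mem_inter.2 ⟨hu, Finset.mem_Icc.2 ?_⟩, ?_⟩
    · omega
    · split_ifs <;> omega
  calc 2 ^ m = (Finset.Ico (2 ^ m) (2 * 2 ^ m)).card := by rw [Nat.card_Ico]; omega
    _ ≤ _ := Finset.card_le_card hsub
    _ ≤ _ := Finset.card_image_le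
end
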